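/- There is a W-equivariant deformation retraction from Ω_reg onto Υ_reg^N; in particular, when W is infinite, Υ_reg is homotopy equivalent to S¹ × Ω_reg, and when W is finite, Υ_reg = Ω_reg. -/

import Mathlib

noncomputable def coxEntry {B : Type*} (M : CoxeterMatrix B) (s t : B) : ℝ :=
  if M s t = 0 then -2 else -2 * Real.cos (Real.pi / (M s t))

noncomputable def coxForm {B : Type*} [Fintype B] (M : CoxeterMatrix B) (v w : B → ℝ) : ℝ :=
  ∑ s, ∑ t, v s * w t * coxEntry M s t

/-- The simple root `α_s` in `RΛ ≅ (B → ℝ)`. -/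
noncomputable def simpleRoot {B : Type*} [DecidableEq B] (s : B) : B → ℝ := Pi.single s 1

/-- The set of real roots: the `W`-orbit of the simple roots under the Tits representation. -/
def rootSet {B : Type*} [DecidableEq B] {W : Type*} [Group W]
    (ρ : W →* ((B → ℝ) ≃ₗ[ℝ] (B → ℝ))) : Set (B → ℝ) :=
  {v | ∃ (w : W) (s : B), v = ρ w (simpleRoot s)}

/-- The set of positive real roots. -/
def posRootSet {B : Type*} [DecidableEq B] {W : Type*} [Group W]
    (ρ : W →* ((B → ℝ) ≃ₗ[ℝ] (B → ℝ))) : Set (B → ℝ) :=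
  {v ∈ rootSet ρ | ∀ i, 0 ≤ v i}

/-- The set `K = {v ∈ ℝ_{≥0}Λ : B(v, α_s) ≤ 0 for all s}`. -/
noncomputable def coneK {B : Type*} [Fintype B] [DecidableEq B] (M : CoxeterMatrix B) :
    Set (B → ℝ) :=
  {v | (∀ i, 0 ≤ v i) ∧ ∀ s, coxForm M v (simpleRoot s) ≤ 0}

/-- The closed imaginary cone `I = closure (W · K)`. -/
noncomputable def imagCone {B : Type*} [Fintype B] [DecidableEq B] (M : CoxeterMatrix B)
    {W : Type*} [Group W] (ρ : W →* ((B → ℝ) ≃ₗ[ℝ] (B → ℝ))) : Set (B → ℝ) :=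
  closure {v | ∃ (w : W), ∃ k ∈ coneK M, v = ρ w k}


/-- The pairing between the dual space `(RΛ)*` (in coordinates: `z : B → ℝ`, with
`z i = Z(α_i)`) and `RΛ`. -/
def evalR {B : Type*} [Fintype B] (z : B → ℝ) (v : B → ℝ) : ℝ := ∑ i, v i * z i

/-- The Tits cone `T = W · C̄` in the dual space, written in coordinates. -/
def titsConeCoord {B : Type*} [Fintype B] [DecidableEq B] {W : Type*} [Group W]
    (ρ : W →* ((B → ℝ) ≃ₗ[ℝ] (B → ℝ))) : Set (B → ℝ) :=
  {z | ∃ w : W, ∀ s : B, 0 ≤ evalR z (ρ w (simpleRoot s))}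

/-- The pairing between the complexified dual space `(RΛ)*_ℂ = Hom_ℝ(RΛ, ℂ)` (in coordinates:
`z : B → ℂ`, with `z i = Z(α_i)`) and `RΛ`. -/
noncomputable def evalC {B : Type*} [Fintype B] (z : B → ℂ) (v : B → ℝ) : ℂ := ∑ i, (v i : ℂ) * z i

/-- The hyperplane complement `Υ_reg`: the complement in `(RΛ)*_ℂ` of the hyperplanes `H_v`
for nonzero `v` in the closed imaginary cone and the hyperplanes `H_α` for positive real
roots `α`. -/
noncomputable def upsReg {B : Type*} [Fintype B] [DecidableEq B] (M : CoxeterMatrix B)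
    {W : Type*} [Group W] (ρ : W →* ((B → ℝ) ≃ₗ[ℝ] (B → ℝ))) : Set (B → ℂ) :=
  {z | (∀ v ∈ imagCone M ρ, v ≠ 0 → evalC z v ≠ 0) ∧ ∀ α ∈ posRootSet ρ, evalC z α ≠ 0}

/-- The argument `φ^I(Z)` of the middle ray of the proper closed convex cone `Z(I) ⊆ ℂ`
(for `Z ∈ Υ` with `I ≠ {0}`): the average of the extremal arguments of `Z(I \ {0})`. -/
noncomputable def phiI {B : Type*} [Fintype B] [DecidableEq B] (M : CoxeterMatrix B)
    {W : Type*} [Group W] (ρ : W →* ((B → ℝ) ≃ₗ[ℝ] (B → ℝ))) (z : B → ℂ) : ℝ :=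
  (sSup (Complex.arg '' ((fun v => evalC z v) '' (imagCone M ρ \ {0}))) +
    sInf (Complex.arg '' ((fun v => evalC z v) '' (imagCone M ρ \ {0})))) / 2

open Classical in
/-- The normalised hyperplane complement `Υ_reg^N = {Z ∈ Υ_reg : φ^I(Z) = π/2}`; by
convention `Υ_reg^N := Υ_reg` when `I = {0}`. -/
noncomputable def upsRegN {B : Type*} [Fintype B] [DecidableEq B] (M : CoxeterMatrix B)
    {W : Type*} [Group W] (ρ : W →* ((B → ℝ) ≃ₗ[ℝ] (B → ℝ))) : Set (B → ℂ) :=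
  if imagCone M ρ = {0} then upsReg M ρ
  else {z ∈ upsReg M ρ | phiI M ρ z = Real.pi / 2}

/-- The contragredient action of `w ∈ W` on the complexified dual space, in coordinates:
`(w · Z)(v) = Z(ρ(w⁻¹) v)`. -/
noncomputable def wact {B : Type*} [Fintype B] [DecidableEq B]
    {W : Type*} [Group W] (ρ : W →* ((B → ℝ) ≃ₗ[ℝ] (B → ℝ))) (w : W) (z : B → ℂ) :
    B → ℂ :=
  fun i => evalC z (ρ w⁻¹ (simpleRoot i))

/-- Van der Lek's complexified hyperplane complement `Ω_reg`: functionals whose imaginary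
part lies in the interior of the Tits cone, minus the root hyperplanes. -/
noncomputable def omegaReg {B : Type*} [Fintype B] [DecidableEq B] (M : CoxeterMatrix B)
    {W : Type*} [Group W] (ρ : W →* ((B → ℝ) ≃ₗ[ℝ] (B → ℝ))) : Set (B → ℂ) :=
  {z | (fun i => (z i).im) ∈ interior (titsConeCoord ρ) ∧
    ∀ α ∈ posRootSet ρ, evalC z α ≠ 0}

set_option linter.unusedSectionVars false
set_option linter.unusedSimpArgs false

/-! ### The bilinear form -/

/-- `coxForm` as a bilinear map. -/
noncomputable def bfm {B : Type*} [Fintype B] (M : CoxeterMatrix B) :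
    (B → ℝ) →ₗ[ℝ] (B → ℝ) →ₗ[ℝ] ℝ :=
  LinearMap.mk₂ ℝ (coxForm M)
    (by intro a b c; simp only [coxForm, Pi.add_apply, ← Finset.sum_add_distrib]
        refine Finset.sum_congr rfl fun s _ => Finset.sum_congr rfl fun t _ => by ring)
    (by intro r b c; simp only [coxForm, Pi.smul_apply, smul_eq_mul, Finset.mul_sum]
        refine Finset.sum_congr rfl fun s _ => Finset.sum_congr rfl fun t _ => by ring)
    (by intro a b c; simp only [coxForm, Pi.add_apply, ← Finset.sum_add_distrib]
        refine Finset.sum_congr rfl fun s _ => Finset.sum_congr rfl fun t _ => by ring)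
    (by intro r b c; simp only [coxForm, Pi.smul_apply, smul_eq_mul, Finset.mul_sum]
        refine Finset.sum_congr rfl fun s _ => Finset.sum_congr rfl fun t _ => by ring)

theorem coxForm_eq {B : Type*} [Fintype B] (M : CoxeterMatrix B) (v w : B → ℝ) :
    coxForm M v w = bfm M v w := rfl

theorem coxEntry_symm {B : Type*} (M : CoxeterMatrix B) (s t : B) :
    coxEntry M s t = coxEntry M t s := by
  unfold coxEntry; rw [M.symmetric s t]

theorem coxEntry_self {B : Type*} (M : CoxeterMatrix B) (s : B) : coxEntry M s s = 2 := by
  unfold coxEntry; simp [M.diagonal s]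

theorem coxEntry_nonpos {B : Type*} (M : CoxeterMatrix B) {s t : B} (h : s ≠ t) :
    coxEntry M s t ≤ 0 := by
  unfold coxEntry
  split_ifs with h0
  · norm_num
  · have h1 := M.off_diagonal s t h
    have h2 : 2 ≤ M s t := by omega
    have h3 : (2:ℝ) ≤ M s t := by exact_mod_cast h2
    have : 0 ≤ Real.cos (Real.pi / (M s t)) := by
      apply Real.cos_nonneg_of_neg_pi_div_two_le_of_le
      · have : 0 ≤ Real.pi / (M s t) := by positivity
        linarith [Real.pi_pos]
      · exact div_le_div_of_nonneg_left Real.pi_pos.le (by norm_num) h3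
    linarith

section
variable {B : Type*} [Fintype B] [DecidableEq B] (M : CoxeterMatrix B)

theorem bfm_symm (v w : B → ℝ) : bfm M v w = bfm M w v := by
  rw [← coxForm_eq, ← coxForm_eq]
  unfold coxForm
  rw [Finset.sum_comm]
  refine Finset.sum_congr rfl fun s _ => Finset.sum_congr rfl fun t _ => ?_
  rw [coxEntry_symm]; ring

theorem bfm_simple (s t : B) : bfm M (simpleRoot s) (simpleRoot t) = coxEntry M s t := by
  rw [← coxForm_eq]
  unfold coxForm simpleRoot
  simp [Pi.single_apply]

theorem vec_eq_sum (v : B → ℝ) : v = ∑ i, v i • simpleRoot i := by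
  ext j; simp [simpleRoot, Pi.single_apply]

theorem lin_eq_sum {E : Type*} [AddCommGroup E] [Module ℝ E] (f : (B → ℝ) →ₗ[ℝ] E) (v : B → ℝ) :
    f v = ∑ i, v i • f (simpleRoot i) := by
  conv_lhs => rw [vec_eq_sum v]
  simp

theorem bfm_sum_right (v w : B → ℝ) : bfm M v w = ∑ i, w i * bfm M v (simpleRoot i) := by
  rw [lin_eq_sum (bfm M v) w]; simp

theorem bfm_sum_left (v w : B → ℝ) : bfm M v w = ∑ i, v i * bfm M (simpleRoot i) w := by
  rw [bfm_symm, bfm_sum_right]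
  simp only [bfm_symm]

theorem bfm_continuous : Continuous fun p : (B → ℝ) × (B → ℝ) => bfm M p.1 p.2 := by
  simp only [← coxForm_eq]; unfold coxForm
  fun_prop

theorem simpleRoot_nonneg (s : B) : ∀ i, 0 ≤ (simpleRoot s : B → ℝ) i := by
  intro i; unfold simpleRoot; rw [Pi.single_apply]; split_ifs <;> norm_num

theorem simpleRoot_self (s : B) : (simpleRoot s : B → ℝ) s = 1 := by simp [simpleRoot]

theorem simpleRoot_ne {s t : B} (h : t ≠ s) : (simpleRoot s : B → ℝ) t = 0 := by
  simp [simpleRoot, h]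
end

/-- `ρ` is the Tits representation. -/
def IsTits {B : Type*} [Fintype B] [DecidableEq B] {M : CoxeterMatrix B}
    {W : Type*} [Group W] (cs : CoxeterSystem M W)
    (ρ : W →* ((B → ℝ) ≃ₗ[ℝ] (B → ℝ))) : Prop :=
  ∀ (s : B) (v : B → ℝ), ρ (cs.simple s) v = v - bfm M (simpleRoot s) v • simpleRoot s

section
variable {B : Type*} [Fintype B] [DecidableEq B] {M : CoxeterMatrix B}
    {W : Type*} [Group W] {cs : CoxeterSystem M W}
    {ρ : W →* ((B → ℝ) ≃ₗ[ℝ] (B → ℝ))}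

theorem IsTits.mul_apply (_h : IsTits cs ρ) (u w : W) (v : B → ℝ) : ρ (u * w) v = ρ u (ρ w v) := by
  rw [map_mul]; rfl

theorem IsTits.one_apply (_h : IsTits cs ρ) (v : B → ℝ) : ρ 1 v = v := by
  rw [map_one]; rfl

theorem IsTits.inv_apply (h : IsTits cs ρ) (w : W) (v : B → ℝ) : ρ w⁻¹ (ρ w v) = v := by
  rw [← h.mul_apply]; simp

theorem IsTits.apply_inv (h : IsTits cs ρ) (w : W) (v : B → ℝ) : ρ w (ρ w⁻¹ v) = v := by
  rw [← h.mul_apply]; simp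

theorem IsTits.simple_self (h : IsTits cs ρ) (s : B) :
    ρ (cs.simple s) (simpleRoot s) = - simpleRoot s := by
  rw [h, bfm_simple, coxEntry_self]; module

theorem IsTits.simple_simple (h : IsTits cs ρ) (s : B) (v : B → ℝ) :
    ρ (cs.simple s) (ρ (cs.simple s) v) = v := by
  rw [← h.mul_apply]; simp

theorem IsTits.form_inv (h : IsTits cs ρ) (w : W) (x y : B → ℝ) :
    bfm M (ρ w x) (ρ w y) = bfm M x y := by
  induction w using cs.simple_induction_left with
  | one => simp
  | mul_simple_left w s ih =>
    rw [h.mul_apply, h.mul_apply, h, h]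
    simp only [map_sub, map_smul, LinearMap.sub_apply, LinearMap.smul_apply, smul_eq_mul,
      bfm_simple, coxEntry_self, ih]
    rw [bfm_symm M _ (simpleRoot s)]
    ring

/-! ### Dihedral computation -/

/-- Coefficients `sin (kθ) / sin θ`. -/
noncomputable def ucoef (c : ℝ) : ℕ → ℝ
  | 0 => 0
  | 1 => 1
  | (k+2) => -c * ucoef c (k+1) - ucoef c k

theorem ucoef_sin (θ : ℝ) (k : ℕ) :
    ucoef (-2 * Real.cos θ) k * Real.sin θ = Real.sin (k * θ) := by
  induction k using Nat.twoStepInduction with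
  | zero => simp [ucoef]
  | one => simp [ucoef]
  | more k h1 h2 =>
    simp only [ucoef, sub_mul]
    rw [h1, mul_assoc, h2]
    have e1 : ((k+2 : ℕ) : ℝ) * θ = (k+1 : ℕ) * θ + θ := by push_cast; ring
    have e2 : (k : ℝ) * θ = (k+1 : ℕ) * θ - θ := by push_cast; ring
    rw [e1, e2, Real.sin_add, Real.sin_sub]; ring

theorem ucoef_two (k : ℕ) : ucoef (-2) k = k := by
  induction k using Nat.twoStepInduction with
  | zero => simp [ucoef]
  | one => simp [ucoef]
  | more k h1 h2 =>
    simp only [ucoef]; rw [h1, h2]; push_cast; ring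

theorem ucoef_nonneg (M : CoxeterMatrix B) {s t : B} (hst : s ≠ t) (k : ℕ)
    (hk : M s t = 0 ∨ k ≤ M s t) : 0 ≤ ucoef (coxEntry M s t) k := by
  unfold coxEntry
  split_ifs with h0
  · rw [ucoef_two]; positivity
  · have hk := hk.resolve_left h0
    have h1 := M.off_diagonal s t hst
    have h2 : 2 ≤ M s t := by omega
    have h3 : (2:ℝ) ≤ M s t := by exact_mod_cast h2
    have hk' : (k:ℝ) ≤ M s t := by exact_mod_cast hk
    have hs := ucoef_sin (Real.pi / (M s t)) k
    have hpos : 0 < Real.sin (Real.pi / (M s t)) := by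
      apply Real.sin_pos_of_pos_of_lt_pi
      · positivity
      · exact div_lt_self Real.pi_pos (by linarith)
    have : 0 ≤ Real.sin (k * (Real.pi / (M s t))) := by
      apply Real.sin_nonneg_of_nonneg_of_le_pi
      · positivity
      · rw [mul_div_assoc', div_le_iff₀ (by linarith), mul_comm]
        exact mul_le_mul_of_nonneg_left hk' Real.pi_pos.le
    rw [← hs] at this
    exact nonneg_of_mul_nonneg_left this hpos

theorem IsTits.alt_apply (h : IsTits cs ρ) (s t : B) (k : ℕ) :
    ρ (cs.wordProd (CoxeterSystem.alternatingWord s t k)) (simpleRoot s) =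
      ucoef (coxEntry M s t) (k+1) • simpleRoot (if Even k then s else t) +
      ucoef (coxEntry M s t) k • simpleRoot (if Even k then t else s) := by
  induction k with
  | zero => simp [ucoef, CoxeterSystem.alternatingWord]
  | succ k ih =>
    rw [CoxeterSystem.alternatingWord_succ', cs.wordProd_cons, h.mul_apply, ih, map_add, map_smul,
      map_smul]
    by_cases hk : Even k
    · have hk' : ¬ Even (k+1) := by simpa [Nat.even_add_one] using hk
      simp only [hk, hk', if_true, if_false, h.simple_self]
      rw [h, bfm_simple, coxEntry_symm M t s]
      simp only [ucoef]; module
    · have hk' : Even (k+1) := by simpa [Nat.even_add_one] using hk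
      simp only [hk, hk', if_true, if_false, h.simple_self]
      rw [h, bfm_simple]
      simp only [ucoef]; module

/-! ### Positivity of roots -/

theorem IsTits.pos_of_length (h : IsTits cs ρ) (n : ℕ) : ∀ (w : W) (s : B), cs.length w = n →
    cs.length w < cs.length (w * cs.simple s) → ∀ i, 0 ≤ ρ w (simpleRoot s) i := by
  induction n using Nat.strong_induction_on with
  | _ n IH =>
  intro w s hn hs
  by_cases hw : w = 1
  · subst hw; rw [h.one_apply]; exact simpleRoot_nonneg s
  obtain ⟨t, ht⟩ := cs.exists_rightDescent_of_ne_one hw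
  unfold CoxeterSystem.IsRightDescent at ht
  have hst : s ≠ t := by rintro rfl; omega
  let P : ℕ → Prop := fun k => ∃ v, w = v * cs.wordProd (CoxeterSystem.alternatingWord s t k) ∧
    cs.length w = cs.length v + k
  have hPb : ∀ k, P k → k ≤ cs.length w := by rintro k ⟨v, _, h2⟩; omega
  have hP1 : P 1 := by
    refine ⟨w * cs.simple t, by simp [CoxeterSystem.alternatingWord], ?_⟩
    rcases cs.length_mul_simple w t with h1 | h1 <;> omega
  have hlen : ∀ k, cs.length (cs.wordProd (CoxeterSystem.alternatingWord s t k)) ≤ k := by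
    intro k; simpa using cs.length_wordProd_le (CoxeterSystem.alternatingWord s t k)
  have hdown : ∀ k, P (k+1) → P k := by
    rintro k ⟨v, h1, h2⟩
    rw [CoxeterSystem.alternatingWord_succ', cs.wordProd_cons, ← mul_assoc] at h1
    refine ⟨_, h1, ?_⟩
    have h3 := cs.length_mul_le v (cs.simple (if Even k then t else s))
    rw [cs.length_simple] at h3
    have h4 := cs.length_mul_le (v * cs.simple (if Even k then t else s))
      (cs.wordProd (CoxeterSystem.alternatingWord s t k))
    rw [← h1] at h4
    have := hlen k
    omega
  have hdown' : ∀ j k, j ≤ k → P k → P j := by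
    intro j k hjk
    induction k, hjk using Nat.le_induction with
    | base => exact id
    | succ k _ ih => exact fun hk => ih (hdown k hk)
  have hm : ∀ k, P k → M s t = 0 ∨ k < M s t := by
    intro k hk
    by_contra hcon
    push Not at hcon
    obtain ⟨v, h1, h2⟩ := hdown' _ _ hcon.2 hk
    obtain ⟨m, hm⟩ := Nat.exists_eq_succ_of_ne_zero hcon.1
    have h3 := cs.wordProd_braidWord_eq s t
    unfold CoxeterSystem.braidWord at h3
    rw [h3, M.symmetric t s, hm, Nat.succ_eq_add_one, CoxeterSystem.alternatingWord_succ,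
      List.concat_eq_append, cs.wordProd_append, cs.wordProd_singleton, ← mul_assoc] at h1
    have h4 : w * cs.simple s = v * cs.wordProd (CoxeterSystem.alternatingWord s t m) := by
      rw [h1]; simp
    have h5 := cs.length_mul_le v (cs.wordProd (CoxeterSystem.alternatingWord s t m))
    rw [← h4] at h5
    have := hlen m
    omega
  classical
  let k := Nat.findGreatest P (cs.length w)
  have hk : P k := Nat.findGreatest_spec (P := P) (hPb 1 hP1) hP1
  have hk1 : 1 ≤ k := Nat.le_findGreatest (hPb 1 hP1) hP1
  have hmax : ¬ P (k+1) := fun hp => by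
    have := Nat.le_findGreatest (P := P) (hPb _ hp) hp
    change k + 1 ≤ k at this
    omega
  have hkm := hm k hk
  obtain ⟨v, h1, h2⟩ := hk
  -- next letter
  have hA : cs.length v < cs.length (v * cs.simple (if Even k then t else s)) := by
    by_contra hcon
    apply hmax
    refine ⟨v * cs.simple (if Even k then t else s), ?_, ?_⟩
    · rw [CoxeterSystem.alternatingWord_succ', cs.wordProd_cons, ← mul_assoc]; simpa using h1
    · rcases cs.length_mul_simple v (if Even k then t else s) with h3 | h3 <;> omega
  have hB : cs.length v < cs.length (v * cs.simple (if Even k then s else t)) := by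
    by_contra hcon
    obtain ⟨j, hj⟩ : ∃ j, k = j + 1 := ⟨k-1, by omega⟩
    rw [hj, CoxeterSystem.alternatingWord_succ', cs.wordProd_cons, ← mul_assoc] at h1
    have hpar : (if Even k then s else t) = (if Even j then t else s) := by
      rw [hj]; by_cases hj : Even j <;> simp [hj, Nat.even_add_one]
    rw [hpar] at hcon
    have h4 := cs.length_mul_le (v * cs.simple (if Even j then t else s))
      (cs.wordProd (CoxeterSystem.alternatingWord s t j))
    rw [← h1] at h4
    have := hlen j
    rcases cs.length_mul_simple v (if Even j then t else s) with h3 | h3 <;> omega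
  have rA := IH (cs.length v) (by omega) v _ rfl hA
  have rB := IH (cs.length v) (by omega) v _ rfl hB
  intro i
  rw [h1, h.mul_apply, h.alt_apply, map_add, map_smul, map_smul]
  simp only [Pi.add_apply, Pi.smul_apply, smul_eq_mul]
  have u1 := ucoef_nonneg M hst (k+1) (by omega)
  have u2 := ucoef_nonneg M hst k (by omega)
  exact add_nonneg (mul_nonneg u1 (rB i)) (mul_nonneg u2 (rA i))

end

set_option linter.unusedSectionVars false
set_option linter.unusedSimpArgs false

section
variable {B : Type*} [Fintype B] [DecidableEq B] {M : CoxeterMatrix B}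
    {W : Type*} [Group W] {cs : CoxeterSystem M W}
    {ρ : W →* ((B → ℝ) ≃ₗ[ℝ] (B → ℝ))}

theorem IsTits.mul_simple_self (h : IsTits cs ρ) (w : W) (s : B) :
    ρ (w * cs.simple s) (simpleRoot s) = - ρ w (simpleRoot s) := by
  rw [h.mul_apply, h.simple_self, map_neg]

theorem IsTits.neg_of_length (h : IsTits cs ρ) (w : W) (s : B)
    (hs : cs.length (w * cs.simple s) < cs.length w) : ∀ i, ρ w (simpleRoot s) i ≤ 0 := by
  intro i
  have := h.pos_of_length _ (w * cs.simple s) s rfl (by simpa using hs) i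
  rw [h.mul_simple_self, Pi.neg_apply] at this
  linarith

theorem IsTits.pos_or_neg (h : IsTits cs ρ) (w : W) (s : B) :
    (∀ i, 0 ≤ ρ w (simpleRoot s) i) ∨ (∀ i, ρ w (simpleRoot s) i ≤ 0) := by
  rcases lt_or_gt_of_ne (cs.length_mul_simple_ne w s) with h1 | h1
  · exact Or.inr (h.neg_of_length w s h1)
  · exact Or.inl (h.pos_of_length _ w s rfl h1)

theorem IsTits.root_pos_or_neg (h : IsTits cs ρ) {α : B → ℝ} (hα : α ∈ rootSet ρ) :
    (∀ i, 0 ≤ α i) ∨ (∀ i, α i ≤ 0) := by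
  obtain ⟨w, s, rfl⟩ := hα
  exact h.pos_or_neg w s

theorem IsTits.root_map (h : IsTits cs ρ) {α : B → ℝ} (hα : α ∈ rootSet ρ) (u : W) :
    ρ u α ∈ rootSet ρ := by
  obtain ⟨w, s, rfl⟩ := hα
  exact ⟨u * w, s, (h.mul_apply _ _ _).symm⟩

theorem IsTits.root_form (h : IsTits cs ρ) {α : B → ℝ} (hα : α ∈ rootSet ρ) :
    bfm M α α = 2 := by
  obtain ⟨w, s, rfl⟩ := hα
  rw [h.form_inv, bfm_simple, coxEntry_self]

theorem IsTits.root_ne_zero (h : IsTits cs ρ) {α : B → ℝ} (hα : α ∈ rootSet ρ) : α ≠ 0 := by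
  rintro rfl
  have := h.root_form hα
  simp at this

theorem IsTits.simple_mem (h : IsTits cs ρ) (s : B) : simpleRoot s ∈ posRootSet ρ :=
  ⟨⟨1, s, (h.one_apply _).symm⟩, simpleRoot_nonneg s⟩

theorem IsTits.eq_one_of_pos (h : IsTits cs ρ) (w : W)
    (hw : ∀ s, ∀ i, 0 ≤ ρ w (simpleRoot s) i) : w = 1 := by
  by_contra hne
  obtain ⟨s, hs⟩ := cs.exists_rightDescent_of_ne_one hne
  have h1 := h.neg_of_length w s hs
  apply h.root_ne_zero (α := ρ w (simpleRoot s)) ⟨w, s, rfl⟩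
  ext i
  exact le_antisymm (h1 i) (hw s i)

/-- The reflection in a root. -/
theorem IsTits.exists_reflection (h : IsTits cs ρ) {α : B → ℝ} (hα : α ∈ rootSet ρ) :
    ∃ r : W, r * r = 1 ∧ ∀ v, ρ r v = v - bfm M α v • α := by
  obtain ⟨w, s, rfl⟩ := hα
  refine ⟨w * cs.simple s * w⁻¹, by simp [mul_assoc], fun v => ?_⟩
  rw [h.mul_apply, h.mul_apply, h, map_sub, map_smul, h.apply_inv]
  congr 2
  rw [← h.form_inv w, h.apply_inv]

theorem IsTits.simple_pos (h : IsTits cs ρ) {α : B → ℝ} (hα : α ∈ posRootSet ρ) {s : B}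
    (hs : α ≠ simpleRoot s) : ρ (cs.simple s) α ∈ posRootSet ρ := by
  have hr := h.root_map hα.1 (cs.simple s)
  refine ⟨hr, ?_⟩
  rcases h.root_pos_or_neg hr with h1 | h1
  · exact h1
  exfalso
  have hz : ∀ i, i ≠ s → α i = 0 := by
    intro i hi
    have := h1 i
    rw [h] at this
    simp [simpleRoot_ne hi] at this
    exact le_antisymm this (hα.2 i)
  have he : α = α s • simpleRoot s := by
    ext i
    by_cases hi : i = s
    · subst hi; simp [simpleRoot_self]
    · simp [hz i hi, simpleRoot_ne hi]
  have hf := h.root_form hα.1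
  rw [he] at hf
  simp only [map_smul, LinearMap.smul_apply, smul_eq_mul, bfm_simple, coxEntry_self] at hf
  have h0 := hα.2 s
  have : α s = 1 := by nlinarith
  rw [this, one_smul] at he
  exact hs he

/-! ### Negative sets of functionals -/

/-- Positive roots on which `f` is negative. -/
def negSet (ρ : W →* ((B → ℝ) ≃ₗ[ℝ] (B → ℝ))) (f : (B → ℝ) →ₗ[ℝ] ℝ) : Set (B → ℝ) :=
  {α ∈ posRootSet ρ | f α < 0}

theorem IsTits.exists_of_negSet_finite (h : IsTits cs ρ) (n : ℕ) :
    ∀ (f : (B → ℝ) →ₗ[ℝ] ℝ), (negSet ρ f).Finite → (negSet ρ f).ncard = n →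
      ∃ w : W, ∀ s, 0 ≤ f (ρ w (simpleRoot s)) := by
  induction n using Nat.strong_induction_on with
  | _ n IH =>
  intro f hf hn
  by_cases hall : ∀ s, 0 ≤ f (simpleRoot s)
  · exact ⟨1, fun s => by rw [h.one_apply]; exact hall s⟩
  push Not at hall
  obtain ⟨s, hs⟩ := hall
  let f' : (B → ℝ) →ₗ[ℝ] ℝ := f.comp (ρ (cs.simple s)).toLinearMap
  have hf' : ∀ v, f' v = f (ρ (cs.simple s) v) := fun v => rfl
  have hmem : simpleRoot s ∈ negSet ρ f := ⟨h.simple_mem s, hs⟩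
  have hsub : (ρ (cs.simple s)) '' negSet ρ f' ⊆ negSet ρ f \ {simpleRoot s} := by
    rintro _ ⟨α, ⟨hα, hfa⟩, rfl⟩
    rw [hf'] at hfa
    have hne : α ≠ simpleRoot s := by
      rintro rfl
      rw [h.simple_self, map_neg] at hfa
      linarith
    refine ⟨⟨h.simple_pos hα hne, hfa⟩, ?_⟩
    intro heq
    rw [Set.mem_singleton_iff] at heq
    have h2 : α = - simpleRoot s := by
      rw [← h.simple_simple s α, heq, h.simple_self]
    have := hα.2 s
    rw [h2, Pi.neg_apply, simpleRoot_self] at this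
    linarith
  have hinj : Function.Injective (ρ (cs.simple s)) := (ρ (cs.simple s)).injective
  have hfin : (negSet ρ f').Finite :=
    ((hf.subset (hsub.trans Set.sdiff_subset))).of_finite_image hinj.injOn
  have hlt : (negSet ρ f').ncard < n := by
    rw [← Set.ncard_image_of_injective _ hinj, ← hn]
    refine lt_of_le_of_lt (Set.ncard_le_ncard hsub hf.sdiff) ?_
    exact Set.ncard_sdiff_singleton_lt_of_mem hmem hf
  obtain ⟨w, hw⟩ := IH _ hlt f' hfin rfl
  exact ⟨cs.simple s * w, fun t => by rw [h.mul_apply]; exact hw t⟩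

theorem IsTits.inv_finite (h : IsTits cs ρ) (u : W) :
    {α ∈ posRootSet ρ | ¬ ∀ i, 0 ≤ ρ u α i}.Finite := by
  induction u using cs.simple_induction_right with
  | one =>
    convert Set.finite_empty
    ext α
    simp only [Set.mem_ofPred_eq, Set.mem_empty_iff_false, iff_false, not_and, not_not]
    intro hα
    rw [h.one_apply]; exact hα.2
  | mul_simple_right u s ih =>
    have hinj : Function.Injective (ρ (cs.simple s)) := (ρ (cs.simple s)).injective
    refine ((Set.finite_singleton (simpleRoot s)).union
      (ih.preimage (f := ρ (cs.simple s)) hinj.injOn)).subset ?_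
    rintro α ⟨hα, hn⟩
    by_cases he : α = simpleRoot s
    · exact Or.inl he
    · right
      refine ⟨h.simple_pos hα he, ?_⟩
      rwa [h.mul_apply] at hn

theorem IsTits.negSet_finite (h : IsTits cs ρ) (f : (B → ℝ) →ₗ[ℝ] ℝ) (w : W)
    (hw : ∀ s, 0 ≤ f (ρ w (simpleRoot s))) : (negSet ρ f).Finite := by
  refine (h.inv_finite w⁻¹).subset ?_
  rintro α ⟨hα, hf⟩
  refine ⟨hα, fun hc => ?_⟩
  rw [← h.apply_inv w α] at hf
  have := lin_eq_sum (f.comp (ρ w).toLinearMap) (ρ w⁻¹ α)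
  simp only [LinearMap.comp_apply, LinearEquiv.coe_coe, smul_eq_mul] at this
  rw [this] at hf
  exact absurd hf (not_lt.mpr (Finset.sum_nonneg fun i _ => mul_nonneg (hc i) (hw i)))

/-- Evaluation as a linear functional. -/
noncomputable def evl (z : B → ℝ) : (B → ℝ) →ₗ[ℝ] ℝ :=
  ∑ i, z i • LinearMap.proj i

theorem evl_apply (z v : B → ℝ) : evl z v = evalR z v := by
  simp [evl, evalR, mul_comm]

theorem IsTits.tits_iff (h : IsTits cs ρ) (z : B → ℝ) :
    z ∈ titsConeCoord ρ ↔ (negSet ρ (evl z)).Finite := by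
  constructor
  · rintro ⟨w, hw⟩
    exact h.negSet_finite _ w (fun s => by rw [evl_apply]; exact hw s)
  · intro hf
    obtain ⟨w, hw⟩ := h.exists_of_negSet_finite _ _ hf rfl
    exact ⟨w, fun s => by rw [← evl_apply]; exact hw s⟩

theorem IsTits.tits_convex (h : IsTits cs ρ) : Convex ℝ (titsConeCoord ρ) := by
  intro x hx y hy a b ha hb hab
  rw [h.tits_iff] at *
  refine (hx.union hy).subset ?_
  rintro α ⟨hα, hf⟩
  have he : evl (a • x + b • y) α = a * evl x α + b * evl y α := by
    simp only [evl_apply, evalR, Finset.mul_sum, ← Finset.sum_add_distrib]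
    refine Finset.sum_congr rfl fun i _ => ?_
    simp; ring
  by_contra hc
  simp only [negSet, Set.mem_union, Set.mem_ofPred_eq, hα, true_and, not_or, not_lt] at hc
  rw [he] at hf
  have := mul_nonneg ha hc.1
  have := mul_nonneg hb hc.2
  linarith

/-! ### Discreteness -/

theorem IsTits.root_eq_of_reflection (h : IsTits cs ρ) {α β : B → ℝ} (hα : α ∈ posRootSet ρ)
    (hβ : β ∈ posRootSet ρ) (he : ∀ v, v - bfm M α v • α = v - bfm M β v • β) : α = β := by
  have h1 := he α
  rw [h.root_form hα.1] at h1
  have h2 : α = (bfm M β α / 2) • β := by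
    have : (2:ℝ) • α = bfm M β α • β := by
      have := sub_right_inj.mp h1
      exact this
    rw [div_eq_inv_mul, mul_smul, ← this, smul_smul]; norm_num
  set c := bfm M β α / 2
  have h3 := h.root_form hα.1
  rw [h2] at h3
  simp only [map_smul, LinearMap.smul_apply, smul_eq_mul, h.root_form hβ.1] at h3
  have h4 : 0 ≤ c := by
    by_contra hc
    push Not at hc
    apply h.root_ne_zero hα.1
    ext i
    have a1 := hα.2 i
    have a2 := hβ.2 i
    rw [h2] at a1 ⊢
    simp only [Pi.smul_apply, smul_eq_mul, Pi.zero_apply] at *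
    nlinarith
  have : c = 1 := by nlinarith
  rw [h2, this, one_smul]

theorem IsTits.bounded_finite (h : IsTits cs ρ) (R : ℝ) :
    {α ∈ posRootSet ρ | ∑ i, α i ≤ R}.Finite := by
  by_contra hinf
  have hinf : {α ∈ posRootSet ρ | ∑ i, α i ≤ R}.Infinite := hinf
  obtain ⟨x, -, hx⟩ := hinf.exists_accPt_of_subset_isCompact
    (K := Set.Icc (0 : B → ℝ) (fun _ => R)) isCompact_Icc (by
      rintro α ⟨hα, hR⟩
      refine ⟨fun i => hα.2 i, fun i => ?_⟩
      exact (Finset.single_le_sum (fun j _ => hα.2 j) (Finset.mem_univ i)).trans hR)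
  have hxx : bfm M x x = 2 := by
    have hcl : IsClosed {y : B → ℝ | bfm M y y = 2} :=
      isClosed_eq ((bfm_continuous M).comp (continuous_id.prodMk continuous_id)) continuous_const
    have hm := hx.clusterPt
    have : x ∈ closure {y : B → ℝ | bfm M y y = 2} := by
      refine closure_mono ?_ (mem_closure_iff_clusterPt.mpr hm)
      rintro α ⟨hα, _⟩
      exact h.root_form hα.1
    rwa [hcl.closure_eq] at this
  let g : B → (B → ℝ) × (B → ℝ) → ℝ := fun i p =>
    ((simpleRoot i - bfm M p.2 (simpleRoot i) • p.2) -
      bfm M p.1 (simpleRoot i - bfm M p.2 (simpleRoot i) • p.2) • p.1) i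
  have hg : ∀ i, Continuous (g i) := by
    intro i
    have c1 : Continuous fun p : (B → ℝ) × (B → ℝ) =>
        simpleRoot i - bfm M p.2 (simpleRoot i) • p.2 :=
      continuous_const.sub (((bfm_continuous M).comp
        (continuous_snd.prodMk continuous_const)).smul continuous_snd)
    have c2 := c1.sub (((bfm_continuous M).comp
        (continuous_fst.prodMk c1)).smul continuous_fst)
    exact (continuous_apply i).comp c2
  have hgx : ∀ i, 0 < g i (x, x) := by
    intro i
    simp only [g, map_sub, map_smul, hxx, smul_eq_mul, Pi.sub_apply, Pi.smul_apply,
      simpleRoot_self]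
    ring_nf; norm_num
  have hev : ∀ᶠ p in nhds (x, x), ∀ i, 0 < g i p := by
    rw [Filter.eventually_all]
    intro i
    exact (hg i).continuousAt.eventually (lt_mem_nhds (hgx i))
  rw [nhds_prod_eq] at hev
  obtain ⟨U, hU, hUU⟩ :=
    (Filter.eventually_prod_self_iff (r := fun a b => ∀ i, 0 < g i (a, b))).mp hev
  rw [accPt_iff_nhds] at hx
  obtain ⟨α, ⟨hαU, hα⟩, hαx⟩ := hx U hU
  obtain ⟨β, ⟨hβU, hβ⟩, hβx⟩ := hx (U ∩ {α}ᶜ)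
    (Filter.inter_mem hU (isOpen_compl_singleton.mem_nhds (Ne.symm hαx)))
  obtain ⟨r, hr, hr'⟩ := h.exists_reflection hα.1.1
  obtain ⟨q, hq, hq'⟩ := h.exists_reflection hβ.1.1
  have hone : r * q = 1 := by
    apply h.eq_one_of_pos
    intro s
    have h1 := hUU α hαU β hβU.1 s
    rcases h.pos_or_neg (r * q) s with h2 | h2
    · exact h2
    · exfalso
      have := h2 s
      rw [h.mul_apply, hr', hq'] at this
      exact absurd h1 (not_lt.mpr this)
  have hrq : r = q := by
    have : r * q = q * q := by rw [hone, hq]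
    exact mul_right_cancel this
  apply hβU.2
  rw [Set.mem_singleton_iff]
  symm
  apply h.root_eq_of_reflection hα.1 hβ.1
  intro v
  rw [← hr', ← hq', hrq]

end

set_option linter.unusedSectionVars false
set_option linter.unusedSimpArgs false

section
variable {B : Type*} [Fintype B] [DecidableEq B] {M : CoxeterMatrix B}
    {W : Type*} [Group W] {cs : CoxeterSystem M W}
    {ρ : W →* ((B → ℝ) ≃ₗ[ℝ] (B → ℝ))}

/-- The dual of the Tits cone: vectors whose whole orbit is nonnegative. -/
def dualCone (ρ : W →* ((B → ℝ) ≃ₗ[ℝ] (B → ℝ))) : Set (B → ℝ) :=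
  {v | ∀ w i, 0 ≤ ρ w v i}

theorem rho_continuous (w : W) : Continuous fun v => ρ w v :=
  (ρ w).toLinearMap.continuous_of_finiteDimensional

theorem dualCone_closed : IsClosed (dualCone ρ) := by
  have : dualCone ρ = ⋂ w, ⋂ i, {v | 0 ≤ ρ w v i} := by
    ext v; simp [dualCone]
  rw [this]
  refine isClosed_iInter fun w => isClosed_iInter fun i => ?_
  exact isClosed_le continuous_const ((continuous_apply i).comp (rho_continuous w))

theorem dualCone_add {x y : B → ℝ} (hx : x ∈ dualCone ρ) (hy : y ∈ dualCone ρ) :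
    x + y ∈ dualCone ρ := fun w i => by
  rw [map_add]; exact add_nonneg (hx w i) (hy w i)

theorem dualCone_smul {x : B → ℝ} (hx : x ∈ dualCone ρ) {c : ℝ} (hc : 0 ≤ c) :
    c • x ∈ dualCone ρ := fun w i => by
  rw [map_smul]; exact mul_nonneg hc (hx w i)

theorem IsTits.dualCone_map (h : IsTits cs ρ) {x : B → ℝ} (hx : x ∈ dualCone ρ) (u : W) :
    ρ u x ∈ dualCone ρ := fun w i => by
  rw [← h.mul_apply]; exact hx _ i

theorem IsTits.dualCone_nonneg (h : IsTits cs ρ) {x : B → ℝ} (hx : x ∈ dualCone ρ) :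
    ∀ i, 0 ≤ x i := fun i => by
  have := hx 1 i; rwa [h.one_apply] at this

theorem coneK_add {x y : B → ℝ} (hx : x ∈ coneK M) (hy : y ∈ coneK M) : x + y ∈ coneK M := by
  refine ⟨fun i => add_nonneg (hx.1 i) (hy.1 i), fun s => ?_⟩
  have h1 := hx.2 s
  have h2 := hy.2 s
  rw [coxForm_eq] at *
  simp only [map_add, LinearMap.add_apply]
  linarith

theorem IsTits.coneK_sub (h : IsTits cs ρ) {k : B → ℝ} (hk : k ∈ coneK M) : k ∈ dualCone ρ := by
  have key : ∀ n, ∀ w, cs.length w = n → ∀ i, 0 ≤ ρ w k i := by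
    intro n
    induction n with
    | zero =>
      intro w hw
      rw [cs.length_eq_zero_iff] at hw
      subst hw
      rw [h.one_apply]; exact hk.1
    | succ n ih =>
      intro w hw i
      have hne : w ≠ 1 := by
        rintro rfl; simp at hw
      obtain ⟨s, hs⟩ := cs.exists_rightDescent_of_ne_one hne
      have hs' := cs.isRightDescent_iff.mp hs
      have h1 := ih (w * cs.simple s) (by omega)
      have h2 := h.pos_of_length _ (w * cs.simple s) s rfl (by have hs2 : cs.length (w * cs.simple s) < cs.length w := hs; simpa using hs2)
      have e : ρ w k = ρ (w * cs.simple s) k +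
          (- bfm M k (simpleRoot s)) • ρ (w * cs.simple s) (simpleRoot s) := by
        rw [← map_smul, ← map_add]
        rw [h.mul_apply]
        congr 1
        rw [map_add, map_smul, h.simple_self, h, bfm_symm M (simpleRoot s) k]
        module
      rw [e]
      have h3 := hk.2 s
      rw [coxForm_eq] at h3
      exact add_nonneg (h1 i) (mul_nonneg (by linarith) (h2 i))
  exact fun w i => key _ w rfl i

theorem IsTits.imagCone_sub (h : IsTits cs ρ) : imagCone M ρ ⊆ dualCone ρ := by
  apply closure_minimal _ dualCone_closed
  rintro _ ⟨w, k, hk, rfl⟩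
  exact h.dualCone_map (h.coneK_sub hk) w

theorem IsTits.mem_orbit_of_finite (h : IsTits cs ρ) {v : B → ℝ} (hv : v ∈ dualCone ρ)
    (hf : {α ∈ posRootSet ρ | 0 < bfm M v α}.Finite) : ∃ w : W, ∃ k ∈ coneK M, v = ρ w k := by
  have hf' : (negSet ρ (-(bfm M v))).Finite := by
    refine hf.subset ?_
    rintro α ⟨hα, hn⟩
    exact ⟨hα, by simpa using hn⟩
  obtain ⟨w, hw⟩ := h.exists_of_negSet_finite _ _ hf' rfl
  refine ⟨w, ρ w⁻¹ v, ⟨hv w⁻¹, fun s => ?_⟩, (h.apply_inv _ _).symm⟩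
  have := hw s
  rw [coxForm_eq, ← h.form_inv w, h.apply_inv]
  simpa using this

/-! ### The dual cone is contained in the imaginary cone -/

/-- Indices at which `k` is strictly negative. -/
noncomputable def strictSet (M : CoxeterMatrix B) (k : B → ℝ) : Finset B := by
  classical exact Finset.univ.filter fun s => bfm M k (simpleRoot s) < 0

theorem mem_strictSet {k : B → ℝ} {s : B} : s ∈ strictSet M k ↔ bfm M k (simpleRoot s) < 0 := by
  simp [strictSet]

theorem zero_mem_coneK : (0 : B → ℝ) ∈ coneK M := by
  refine ⟨fun i => le_rfl, fun s => ?_⟩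
  rw [coxForm_eq]; simp

theorem exists_generic (M : CoxeterMatrix B) :
    ∃ k ∈ coneK M, ∀ k' ∈ coneK M, strictSet M k ⊆ strictSet M k' →
      strictSet M k' ⊆ strictSet M k := by
  classical
  let P : ℕ → Prop := fun n => ∃ k ∈ coneK M, (strictSet M k).card = n
  have h0 : P (strictSet M (0 : B → ℝ)).card := ⟨0, zero_mem_coneK, rfl⟩
  obtain ⟨k, hk, hc⟩ := Nat.findGreatest_spec (P := P) (Finset.card_le_univ _) h0
  refine ⟨k, hk, fun k' hk' hsub => ?_⟩
  have h1 := Nat.le_findGreatest (P := P) (Finset.card_le_univ (strictSet M k')) ⟨k', hk', rfl⟩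
  rw [← hc] at h1
  exact (Finset.eq_of_subset_of_card_le hsub h1).ge

/-- Genericity. -/
def IsGeneric (M : CoxeterMatrix B) (k : B → ℝ) : Prop :=
  k ∈ coneK M ∧ ∀ k' ∈ coneK M, strictSet M k ⊆ strictSet M k' →
      strictSet M k' ⊆ strictSet M k

theorem IsGeneric.add {k : B → ℝ} (hk : IsGeneric M k) {u : B → ℝ} (hu : u ∈ coneK M) {s : B}
    (hs : s ∉ strictSet M k) : bfm M u (simpleRoot s) = 0 := by
  by_contra hne
  have hu' := hu.2 s
  rw [coxForm_eq] at hu'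
  have hlt : bfm M u (simpleRoot s) < 0 := lt_of_le_of_ne hu' hne
  apply hs
  refine hk.2 (k + u) (coneK_add hk.1 hu) ?_ ?_
  · intro t ht
    rw [mem_strictSet] at *
    have := hu.2 t
    rw [coxForm_eq] at this
    simp only [map_add, LinearMap.add_apply]; linarith
  · rw [mem_strictSet]
    have := hk.1.2 s
    rw [coxForm_eq] at this
    simp only [map_add, LinearMap.add_apply]; linarith

theorem IsGeneric.orth {k : B → ℝ} (hk : IsGeneric M k) {s t : B}
    (hs : s ∉ strictSet M k) (ht : t ∈ strictSet M k) : coxEntry M t s = 0 := by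
  have hst : t ≠ s := by rintro rfl; exact hs ht
  by_contra hne
  have hlt : coxEntry M t s < 0 := lt_of_le_of_ne (coxEntry_nonpos M hst) hne
  have ht' := mem_strictSet.mp ht
  set δ := - bfm M k (simpleRoot t) / 4 with hδ
  have hδ0 : 0 < δ := by rw [hδ]; linarith
  have hval : ∀ u, bfm M (k + δ • simpleRoot t) (simpleRoot u) =
      bfm M k (simpleRoot u) + δ * coxEntry M t u := by
    intro u; simp [bfm_simple]
  have hle : ∀ u, u ≠ t → bfm M (k + δ • simpleRoot t) (simpleRoot u) ≤ bfm M k (simpleRoot u) := by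
    intro u hu
    rw [hval]
    have := mul_nonpos_of_nonneg_of_nonpos hδ0.le (coxEntry_nonpos M (Ne.symm hu))
    linarith
  have htt : bfm M (k + δ • simpleRoot t) (simpleRoot t) < 0 := by
    rw [hval, coxEntry_self, hδ]; linarith
  have hK : ∀ u, bfm M k (simpleRoot u) ≤ 0 := fun u => by
    have := hk.1.2 u; rwa [coxForm_eq] at this
  apply hs
  refine hk.2 (k + δ • simpleRoot t) ⟨fun i => ?_, fun u => ?_⟩ ?_ ?_
  · exact add_nonneg (hk.1.1 i) (mul_nonneg hδ0.le (simpleRoot_nonneg t i))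
  · rw [coxForm_eq]
    by_cases hu : u = t
    · subst hu; exact htt.le
    · exact (hle u hu).trans (hK u)
  · intro u hu
    rw [mem_strictSet] at *
    by_cases hut : u = t
    · subst hut; exact htt
    · exact (hle u hut).trans_lt hu
  · rw [mem_strictSet, hval]
    have := mul_neg_of_pos_of_neg hδ0 hlt
    linarith [hK s]

theorem IsGeneric.orth' {k : B → ℝ} (hk : IsGeneric M k) {x y : B → ℝ}
    (hx : ∀ i ∈ strictSet M k, x i = 0) (hy : ∀ i, i ∉ strictSet M k → y i = 0) :
    bfm M x y = 0 := by
  rw [bfm_sum_right]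
  refine Finset.sum_eq_zero fun i _ => ?_
  by_cases hi : i ∈ strictSet M k
  · rw [bfm_sum_left, Finset.sum_eq_zero, mul_zero]
    intro j _
    by_cases hj : j ∈ strictSet M k
    · rw [hx j hj, zero_mul]
    · rw [bfm_simple, coxEntry_symm, hk.orth hj hi, mul_zero]
  · rw [hy i hi, zero_mul]

theorem bfm_abs_le (x : B → ℝ) : bfm M (fun i => |x i|) (fun i => |x i|) ≤ bfm M x x := by
  rw [← coxForm_eq, ← coxForm_eq]
  unfold coxForm
  refine Finset.sum_le_sum fun s _ => Finset.sum_le_sum fun t _ => ?_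
  by_cases hst : s = t
  · subst hst; rw [abs_mul_abs_self]
  · rw [← abs_mul]
    exact mul_le_mul_of_nonpos_right (le_abs_self _) (coxEntry_nonpos M hst)

theorem IsGeneric.psd {k : B → ℝ} (hk : IsGeneric M k) {x : B → ℝ}
    (hx : ∀ i ∈ strictSet M k, x i = 0) : 0 ≤ bfm M x x := by
  by_contra hneg
  push Not at hneg
  -- compact set
  let C : Set (B → ℝ) := {y | (∀ i, 0 ≤ y i) ∧ (∀ i ∈ strictSet M k, y i = 0) ∧ ∑ i, y i ^ 2 = 1}
  have hCc : IsCompact C := by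
    have hcl : IsClosed C := by
      have e : C = (⋂ i, {y | 0 ≤ y i}) ∩ ((⋂ i ∈ strictSet M k, {y | y i = 0}) ∩
          {y | ∑ i, y i ^ 2 = 1}) := by
        ext y; simp [C]
      rw [e]
      refine (isClosed_iInter fun i => isClosed_le continuous_const (continuous_apply i)).inter
        ((isClosed_biInter fun i _ => isClosed_eq (continuous_apply i) continuous_const).inter
          (isClosed_eq (by fun_prop) continuous_const))
    refine (isCompact_Icc (a := (0 : B → ℝ)) (b := 1)).of_isClosed_subset hcl ?_
    rintro y ⟨h1, _, h3⟩
    refine ⟨h1, fun i => ?_⟩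
    have := Finset.single_le_sum (f := fun j => y j ^ 2) (fun j _ => sq_nonneg (y j))
      (Finset.mem_univ i)
    rw [h3] at this
    simp only [Pi.one_apply]
    nlinarith [h1 i]
  -- normalise
  have hscale : ∀ y : B → ℝ, (∀ i, 0 ≤ y i) → (∀ i ∈ strictSet M k, y i = 0) → y ≠ 0 →
      ∃ c : ℝ, 0 < c ∧ c ^ 2 * ∑ i, y i ^ 2 = 1 ∧ c • y ∈ C := by
    intro y h1 h2 h3
    have hp : 0 < ∑ i, y i ^ 2 := by
      obtain ⟨j, hj⟩ := Function.ne_iff.mp h3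
      refine Finset.sum_pos' (fun i _ => sq_nonneg _) ⟨j, Finset.mem_univ j, ?_⟩
      have : y j ≠ 0 := hj
      positivity
    have hc : (Real.sqrt (∑ i, y i ^ 2))⁻¹ ^ 2 * ∑ i, y i ^ 2 = 1 := by
      rw [inv_pow, Real.sq_sqrt hp.le]; exact inv_mul_cancel₀ hp.ne'
    refine ⟨(Real.sqrt (∑ i, y i ^ 2))⁻¹, by positivity, hc, ?_, ?_, ?_⟩
    · intro i; exact mul_nonneg (by positivity) (h1 i)
    · intro i hi; simp [h2 i hi]
    · simp only [Pi.smul_apply, smul_eq_mul, mul_pow, ← Finset.mul_sum]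
      exact hc
  set x' : B → ℝ := fun i => |x i| with hx'
  have hx'n : bfm M x' x' < 0 := (bfm_abs_le x).trans_lt hneg
  have hx'0 : x' ≠ 0 := by intro h0; rw [h0] at hx'n; simp at hx'n
  obtain ⟨c, hc, -, hcC⟩ := hscale x' (fun i => abs_nonneg _)
    (fun i hi => by simp [hx', hx i hi]) hx'0
  obtain ⟨y, hyC, hymin⟩ := hCc.exists_isMinOn ⟨_, hcC⟩
    (((bfm_continuous M).comp (continuous_id.prodMk continuous_id)).continuousOn (s := C))
  set lam := bfm M y y with hlam
  have hmin : ∀ z ∈ C, lam ≤ bfm M z z := fun z hz => hymin hz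
  have hlam0 : lam < 0 := by
    refine (hmin _ hcC).trans_lt ?_
    simp only [map_smul, LinearMap.smul_apply, smul_eq_mul]
    exact mul_neg_of_pos_of_neg hc (mul_neg_of_pos_of_neg hc hx'n)
  have hhom : ∀ z : B → ℝ, (∀ i, 0 ≤ z i) → (∀ i ∈ strictSet M k, z i = 0) →
      lam * ∑ i, z i ^ 2 ≤ bfm M z z := by
    intro z h1 h2
    by_cases h3 : z = 0
    · subst h3; simp
    obtain ⟨c, hc, hc1, hcz⟩ := hscale z h1 h2 h3
    have := hmin _ hcz
    simp only [map_smul, LinearMap.smul_apply, smul_eq_mul] at this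
    have hc2 : 0 < c ^ 2 := by positivity
    have : c ^ 2 * (lam * ∑ i, z i ^ 2) ≤ c ^ 2 * bfm M z z := by
      calc c ^ 2 * (lam * ∑ i, z i ^ 2) = lam * (c ^ 2 * ∑ i, z i ^ 2) := by ring
        _ = lam := by rw [hc1, mul_one]
        _ ≤ _ := by linarith
    exact le_of_mul_le_mul_left this hc2
  obtain ⟨hy0, hyJ, hy1⟩ := hyC
  have hkey : ∀ s, s ∉ strictSet M k → 0 < y s → bfm M y (simpleRoot s) ≤ lam * y s := by
    intro s hs hys
    by_contra hd
    push Not at hd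
    set d := bfm M y (simpleRoot s) - lam * y s with hdd
    have hd0 : 0 < d := by rw [hdd]; linarith
    have hpert : ∀ ε, 0 < ε → ε ≤ y s → 2 * d ≤ ε * (2 - lam) := by
      intro ε he he'
      have hz := hhom (y - ε • simpleRoot s) (fun i => by
        by_cases hi : i = s
        · subst hi; simp [simpleRoot_self]; exact he'
        · simp [simpleRoot_ne hi]; exact hy0 i) (fun i hi => by
        have : i ≠ s := by rintro rfl; exact hs hi
        simp [simpleRoot_ne this, hyJ i hi])
      have e1 : ∑ i, (y - ε • simpleRoot s) i ^ 2 = 1 - 2 * ε * y s + ε ^ 2 := by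
        have : ∀ i, (y - ε • simpleRoot s) i ^ 2 =
            y i ^ 2 + (if i = s then (- 2 * ε * y s + ε ^ 2) else 0) := by
          intro i
          by_cases hi : i = s
          · subst hi; simp [simpleRoot_self]; ring
          · simp [simpleRoot_ne hi, hi]
        rw [Finset.sum_congr rfl fun i _ => this i, Finset.sum_add_distrib, hy1]
        simp; ring
      have e2 : bfm M (y - ε • simpleRoot s) (y - ε • simpleRoot s) =
          lam - 2 * ε * bfm M y (simpleRoot s) + 2 * ε ^ 2 := by
        simp only [map_sub, map_smul, LinearMap.sub_apply, LinearMap.smul_apply, smul_eq_mul,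
          bfm_simple, coxEntry_self, bfm_symm M (simpleRoot s) y]
        rw [← hlam]; ring
      rw [e1, e2] at hz
      have : ε * (2 * d) ≤ ε * (ε * (2 - lam)) := by rw [hdd]; nlinarith
      exact le_of_mul_le_mul_left this he
    have h2l : 0 < 2 - lam := by linarith
    have hm : 0 < min (y s) (d / (2 - lam)) := lt_min hys (by positivity)
    have := hpert _ hm (min_le_left _ _)
    have h3 : min (y s) (d / (2 - lam)) * (2 - lam) ≤ d := by
      rw [← le_div_iff₀ h2l]; exact min_le_right _ _
    linarith
  have hyK : y ∈ coneK M := by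
    refine ⟨hy0, fun s => ?_⟩
    rw [coxForm_eq]
    by_cases hs : s ∈ strictSet M k
    · rw [hk.orth' hyJ]
      intro i hi
      exact simpleRoot_ne (by rintro rfl; exact hi hs)
    · rcases (hy0 s).eq_or_lt with h0 | h0
      · rw [bfm_sum_left]
        refine Finset.sum_nonpos fun i _ => ?_
        by_cases hi : i = s
        · subst hi; rw [← h0, zero_mul]
        · rw [bfm_simple]
          exact mul_nonpos_of_nonneg_of_nonpos (hy0 i) (coxEntry_nonpos M hi)
      · exact (hkey s hs h0).trans (mul_nonpos_of_nonpos_of_nonneg hlam0.le h0.le)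
  have hpos : ∃ s, 0 < y s := by
    by_contra hcon
    push Not at hcon
    have : y = 0 := by ext i; exact le_antisymm (hcon i) (hy0 i)
    rw [this] at hy1; simp at hy1
  obtain ⟨s, hs⟩ := hpos
  have hsN : s ∉ strictSet M k := fun hh => by rw [hyJ s hh] at hs; exact lt_irrefl _ hs
  have h1 := hk.add hyK hsN
  have h2 := hkey s hsN hs
  have := mul_neg_of_neg_of_pos hlam0 hs
  linarith

theorem IsGeneric.radical {k : B → ℝ} (hk : IsGeneric M k) {x y : B → ℝ}
    (hx : ∀ i ∈ strictSet M k, x i = 0) (hy : ∀ i ∈ strictSet M k, y i = 0)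
    (h0 : bfm M x x = 0) : bfm M x y = 0 := by
  have key : ∀ ε : ℝ, 0 ≤ 2 * ε * bfm M x y + ε ^ 2 * bfm M y y := by
    intro ε
    have := hk.psd (x := x + ε • y) (fun i hi => by simp [hx i hi, hy i hi])
    simp only [map_add, map_smul, LinearMap.add_apply, LinearMap.smul_apply, smul_eq_mul, h0,
      bfm_symm M y x] at this
    linarith
  have hyy := hk.psd hy
  set b := bfm M x y
  set a := bfm M y y
  have h1 := key (-b / (a + 1))
  have h2 : 0 < a + 1 := by linarith
  have h3 : 2 * (-b / (a + 1)) * b + (-b / (a + 1)) ^ 2 * a = - (b ^ 2 * (a + 2)) / (a + 1) ^ 2 := by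
    field_simp; ring
  rw [h3] at h1
  have h4 : 0 ≤ - (b ^ 2 * (a + 2)) := by
    by_contra hc
    push Not at hc
    have := div_neg_of_neg_of_pos hc (by positivity : 0 < (a + 1) ^ 2)
    linarith
  have h5 : b ^ 2 = 0 := by nlinarith [sq_nonneg b]
  exact pow_eq_zero_iff (two_ne_zero) |>.mp h5

end

set_option linter.unusedSectionVars false
set_option linter.unusedSimpArgs false

section P4
variable {B : Type*} [Fintype B] [DecidableEq B] {M : CoxeterMatrix B}
    {W : Type*} [Group W] {cs : CoxeterSystem M W}
    {ρ : W →* ((B → ℝ) ≃ₗ[ℝ] (B → ℝ))}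

theorem IsTits.zero_on (h : IsTits cs ρ) {k : B → ℝ} (hk : IsGeneric M k) {x : B → ℝ}
    (hx : ∀ i ∈ strictSet M k, x i = 0) (w : W) : ∀ i ∈ strictSet M k, ρ w x i = 0 := by
  induction w using cs.simple_induction_left with
  | one => rw [h.one_apply]; exact hx
  | mul_simple_left w s ih =>
    rw [h.mul_apply, h]
    by_cases hs : s ∈ strictSet M k
    · rw [bfm_symm, hk.orth' ih (y := simpleRoot s)]
      · simpa using ih
      · intro i hi; apply simpleRoot_ne; rintro rfl; exact hi hs
    · intro i hi
      have : i ≠ s := by rintro rfl; exact hs hi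
      simp [ih i hi, simpleRoot_ne this]

theorem IsTits.zero_off (h : IsTits cs ρ) {k : B → ℝ} (hk : IsGeneric M k) {x : B → ℝ}
    (hx : ∀ i, i ∉ strictSet M k → x i = 0) (w : W) : ∀ i, i ∉ strictSet M k → ρ w x i = 0 := by
  induction w using cs.simple_induction_left with
  | one => rw [h.one_apply]; exact hx
  | mul_simple_left w s ih =>
    rw [h.mul_apply, h]
    by_cases hs : s ∈ strictSet M k
    · intro i hi
      have : i ≠ s := by rintro rfl; exact hi hs
      simp [ih i hi, simpleRoot_ne this]
    · rw [hk.orth' (x := simpleRoot s) _ ih]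
      · simpa using ih
      · intro i hi; apply simpleRoot_ne; rintro rfl; exact hs hi

theorem IsTits.root_supp (h : IsTits cs ρ) {k : B → ℝ} (hk : IsGeneric M k) {α : B → ℝ}
    (hα : α ∈ rootSet ρ) :
    (∀ i ∈ strictSet M k, α i = 0) ∨ (∀ i, i ∉ strictSet M k → α i = 0) := by
  obtain ⟨w, s, rfl⟩ := hα
  by_cases hs : s ∈ strictSet M k
  · right
    apply h.zero_off hk
    intro i hi; apply simpleRoot_ne; rintro rfl; exact hi hs
  · left
    apply h.zero_on hk
    intro i hi; apply simpleRoot_ne; rintro rfl; exact hs hi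

/-- Projection away from the strict set. -/
noncomputable def projJ (M : CoxeterMatrix B) (k : B → ℝ) (x : B → ℝ) : B → ℝ :=
  fun i => if i ∈ strictSet M k then 0 else x i

theorem projJ_on (k x : B → ℝ) : ∀ i ∈ strictSet M k, projJ M k x i = 0 := by
  intro i hi; simp [projJ, hi]

theorem projJ_off (k x : B → ℝ) : ∀ i, i ∉ strictSet M k → (x - projJ M k x) i = 0 := by
  intro i hi; simp [projJ, hi]

theorem IsTits.projJ_dual (h : IsTits cs ρ) {k : B → ℝ} (hk : IsGeneric M k) {v : B → ℝ}
    (hv : v ∈ dualCone ρ) : projJ M k v ∈ dualCone ρ := by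
  intro w i
  by_cases hi : i ∈ strictSet M k
  · rw [h.zero_on hk (projJ_on k v) w i hi]
  · have h1 := h.zero_off hk (projJ_off k v) w i hi
    rw [map_sub, Pi.sub_apply, sub_eq_zero] at h1
    rw [← h1]; exact hv w i

theorem IsTits.projJ_isotropic (h : IsTits cs ρ) {k : B → ℝ} (hk : IsGeneric M k) {v : B → ℝ}
    (hv : v ∈ dualCone ρ) : bfm M (projJ M k v) (projJ M k v) = 0 := by
  set x := projJ M k v with hx
  have hxd := h.projJ_dual hk hv
  rw [← hx] at hxd
  let D : Set (B → ℝ) := {y | y ∈ dualCone ρ ∧ (∀ i ∈ strictSet M k, y i = 0) ∧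
    bfm M y y = bfm M x x}
  let C : Set (B → ℝ) := D ∩ {y | ∑ i, y i ≤ ∑ i, x i}
  have hDc : IsClosed D := by
    refine dualCone_closed.inter (IsClosed.inter ?_ ?_)
    · have : {y : B → ℝ | ∀ i ∈ strictSet M k, y i = 0} = ⋂ i ∈ strictSet M k, {y | y i = 0} := by
        ext y; simp
      change IsClosed {y : B → ℝ | ∀ i ∈ strictSet M k, y i = 0}
      rw [this]
      exact isClosed_biInter fun i _ => isClosed_eq (continuous_apply i) continuous_const
    · have : Continuous fun y : B → ℝ => bfm M y y :=
        (bfm_continuous M).comp (continuous_id.prodMk continuous_id)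
      exact isClosed_eq this continuous_const
  have hsum : Continuous fun y : B → ℝ => ∑ i, y i := by fun_prop
  have hCc : IsCompact C := by
    refine IsCompact.of_isClosed_subset (s := Set.Icc 0 (fun _ => ∑ i, x i)) isCompact_Icc
      (hDc.inter (isClosed_le hsum continuous_const)) ?_
    rintro y ⟨hy, hy2⟩
    have hy0 := h.dualCone_nonneg hy.1
    refine ⟨hy0, fun i => ?_⟩
    exact (Finset.single_le_sum (f := y) (fun j _ => hy0 j) (Finset.mem_univ i)).trans hy2
  obtain ⟨u, hu, hmin⟩ := hCc.exists_isMinOn ⟨x, ⟨hxd, projJ_on k v, rfl⟩, le_refl (∑ i, x i)⟩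
    hsum.continuousOn
  have huK : u ∈ coneK M := by
    refine ⟨h.dualCone_nonneg hu.1.1, fun s => ?_⟩
    rw [coxForm_eq]
    by_contra hneg
    push Not at hneg
    have e : ∑ i, ρ (cs.simple s) u i = ∑ i, u i - bfm M u (simpleRoot s) := by
      rw [h, bfm_symm]
      simp [Finset.sum_sub_distrib, ← Finset.mul_sum, simpleRoot]
    have hm : ρ (cs.simple s) u ∈ C := by
      refine ⟨⟨h.dualCone_map hu.1.1 _, h.zero_on hk hu.1.2.1 _, ?_⟩, ?_⟩
      · rw [h.form_inv]; exact hu.1.2.2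
      · change ∑ i, ρ (cs.simple s) u i ≤ _
        rw [e]
        have : ∑ i, u i ≤ ∑ i, x i := hu.2
        linarith
    have := hmin hm
    simp only [Set.mem_ofPred_eq] at this
    rw [e] at this
    linarith
  rw [← hu.1.2.2, bfm_sum_right]
  refine Finset.sum_eq_zero fun i _ => ?_
  by_cases hi : i ∈ strictSet M k
  · rw [hu.1.2.1 i hi, zero_mul]
  · rw [hk.add huK hi, mul_zero]

theorem IsTits.mem_orbit_add (h : IsTits cs ρ) {k : B → ℝ} (hk : IsGeneric M k) {v : B → ℝ}
    (hv : v ∈ dualCone ρ) {ε : ℝ} (hε : 0 < ε) :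
    ∃ w : W, ∃ k' ∈ coneK M, v + ε • k = ρ w k' := by
  apply h.mem_orbit_of_finite (dualCone_add hv (dualCone_smul (h.coneK_sub hk.1) hε.le))
  have hv0 := h.dualCone_nonneg hv
  -- uniform bound
  obtain ⟨c, hc, hcb⟩ : ∃ c : ℝ, 0 < c ∧ ∀ i ∈ strictSet M k, bfm M k (simpleRoot i) ≤ -c := by
    rcases (strictSet M k).eq_empty_or_nonempty with he | hne
    · exact ⟨1, one_pos, by simp [he]⟩
    · obtain ⟨j, hj, hj2⟩ := (strictSet M k).exists_max_image
        (fun i => bfm M k (simpleRoot i)) hne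
      refine ⟨- bfm M k (simpleRoot j), by linarith [mem_strictSet.mp hj], fun i hi => ?_⟩
      rw [neg_neg]; exact hj2 i hi
  set R := ∑ i, v i with hR
  have hR0 : 0 ≤ R := Finset.sum_nonneg fun i _ => hv0 i
  refine (h.bounded_finite (R / (ε * c) + 1)).subset ?_
  rintro α ⟨hα, hpos⟩
  refine ⟨hα, ?_⟩
  simp only [map_add, map_smul, LinearMap.add_apply, LinearMap.smul_apply, smul_eq_mul] at hpos
  rcases h.root_supp hk hα.1 with h1 | h1
  · exfalso
    have e1 : bfm M v α = 0 := by
      have : v = projJ M k v + (v - projJ M k v) := by abel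
      rw [this, map_add, LinearMap.add_apply, hk.radical (projJ_on k v) h1 (h.projJ_isotropic hk hv),
        bfm_symm M (v - _), hk.orth' h1 (projJ_off k v), add_zero]
    have e2 : bfm M k α = 0 := by
      rw [bfm_sum_right]
      refine Finset.sum_eq_zero fun i _ => ?_
      by_cases hi : i ∈ strictSet M k
      · rw [h1 i hi, zero_mul]
      · rw [hk.add hk.1 hi, mul_zero]
    rw [e1, e2] at hpos; simp at hpos
  · have e2 : bfm M k α ≤ -c * ∑ i, α i := by
      rw [bfm_sum_right, Finset.mul_sum]
      refine Finset.sum_le_sum fun i _ => ?_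
      by_cases hi : i ∈ strictSet M k
      · have := mul_le_mul_of_nonneg_left (hcb i hi) (hα.2 i)
        linarith
      · rw [h1 i hi]; simp
    obtain ⟨r, -, hr⟩ := h.exists_reflection hα.1
    have h3 : ∀ i, bfm M v α * α i ≤ v i := by
      intro i
      have := hv r i
      rw [hr, bfm_symm] at this
      simp at this; exact this
    have h4 : bfm M v α * ∑ i, α i ≤ R := by
      rw [Finset.mul_sum]; exact Finset.sum_le_sum fun i _ => h3 i
    set t := ∑ i, α i with ht
    have ht0 : 0 ≤ t := Finset.sum_nonneg fun i _ => hα.2 i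
    have h5 : ε * c * t ≤ bfm M v α := by nlinarith
    have h6 : ε * c * (t * t) ≤ R := by
      have := mul_le_mul_of_nonneg_right h5 ht0
      nlinarith
    have hec : 0 < ε * c := by positivity
    have h7 : t * t ≤ R / (ε * c) := by
      rw [le_div_iff₀ hec]; linarith
    nlinarith [sq_nonneg (t - 1)]

theorem IsTits.imagCone_eq (h : IsTits cs ρ) : imagCone M ρ = dualCone ρ := by
  refine Set.Subset.antisymm h.imagCone_sub fun v hv => ?_
  obtain ⟨k, hk⟩ := exists_generic M
  have hk : IsGeneric M k := hk
  have hc : Filter.Tendsto (fun ε : ℝ => v + ε • k) (nhdsWithin 0 (Set.Ioi 0)) (nhds v) := by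
    have : Continuous fun ε : ℝ => v + ε • k := by fun_prop
    have := this.tendsto 0
    rw [zero_smul, add_zero] at this
    exact this.mono_left nhdsWithin_le_nhds
  refine mem_closure_of_tendsto hc ?_
  filter_upwards [self_mem_nhdsWithin] with ε hε
  exact h.mem_orbit_add hk hv hε

theorem evalR_continuous (v : B → ℝ) : Continuous fun z => evalR z v := by
  unfold evalR; fun_prop

theorem evalR_single (v : B → ℝ) (i : B) : evalR (simpleRoot i) v = v i := by
  simp [evalR, simpleRoot, Pi.single_apply]

theorem evalR_simple (z : B → ℝ) (i : B) : evalR z (simpleRoot i) = z i := by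
  simp [evalR, simpleRoot, Pi.single_apply]

theorem evalR_pos_ht {z v : B → ℝ} (hv : ∀ i, 0 ≤ v i) (hz : ∀ i, 0 ≤ z i) : 0 ≤ evalR z v :=
  Finset.sum_nonneg fun i _ => mul_nonneg (hv i) (hz i)

theorem IsTits.tits_nonneg (h : IsTits cs ρ) {z v : B → ℝ} (hz : z ∈ titsConeCoord ρ)
    (hv : v ∈ dualCone ρ) : 0 ≤ evalR z v := by
  obtain ⟨w, hw⟩ := hz
  rw [← evl_apply]
  have e : v = ρ w (ρ w⁻¹ v) := (h.apply_inv w v).symm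
  have := lin_eq_sum ((evl z).comp (ρ w).toLinearMap) (ρ w⁻¹ v)
  simp only [LinearMap.comp_apply, LinearEquiv.coe_coe, h.apply_inv, smul_eq_mul] at this
  rw [this]
  refine Finset.sum_nonneg fun i _ => mul_nonneg (hv _ i) ?_
  rw [evl_apply]; exact hw i

theorem sum_pos_of_nonneg {v : B → ℝ} (hv : ∀ i, 0 ≤ v i) (h0 : v ≠ 0) : 0 < ∑ i, v i := by
  refine lt_of_le_of_ne (Finset.sum_nonneg fun i _ => hv i) fun he => h0 ?_
  rw [eq_comm, Finset.sum_eq_zero_iff_of_nonneg (fun i _ => hv i)] at he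
  ext i; exact he i (Finset.mem_univ i)

theorem IsTits.chamber_int (h : IsTits cs ρ) (w : W) {z : B → ℝ}
    (hz : ∀ s, 0 < evalR z (ρ w (simpleRoot s))) : z ∈ interior (titsConeCoord ρ) := by
  have ho : IsOpen {z | ∀ s, 0 < evalR z (ρ w (simpleRoot s))} := by
    have : {z : B → ℝ | ∀ s, 0 < evalR z (ρ w (simpleRoot s))} =
        ⋂ s, {z | 0 < evalR z (ρ w (simpleRoot s))} := by ext; simp
    rw [this]
    exact isOpen_iInter_of_finite fun s => isOpen_lt continuous_const (evalR_continuous _)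
  have hsub : {z | ∀ s, 0 < evalR z (ρ w (simpleRoot s))} ⊆ titsConeCoord ρ :=
    fun y hy => ⟨w, fun s => le_of_lt (hy s)⟩
  exact interior_maximal hsub ho hz

theorem IsTits.interior_iff (h : IsTits cs ρ) (z : B → ℝ) :
    z ∈ interior (titsConeCoord ρ) ↔ ∀ v ∈ dualCone ρ, v ≠ 0 → 0 < evalR z v := by
  constructor
  · intro hz v hv hv0
    have hsp := sum_pos_of_nonneg (h.dualCone_nonneg hv) hv0
    have hc : Filter.Tendsto (fun ε : ℝ => z - ε • (fun _ : B => (1:ℝ)))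
        (nhdsWithin 0 (Set.Ioi 0)) (nhds z) := by
      have : Continuous fun ε : ℝ => z - ε • (fun _ : B => (1:ℝ)) := by fun_prop
      have := this.tendsto 0
      rw [zero_smul, sub_zero] at this
      exact this.mono_left nhdsWithin_le_nhds
    have h2 := hc.eventually (isOpen_interior.mem_nhds hz)
    obtain ⟨ε, hε, hε0⟩ := (h2.and self_mem_nhdsWithin).exists
    have h3 := h.tits_nonneg (interior_subset hε) hv
    have e : evalR (z - ε • (fun _ : B => (1:ℝ))) v = evalR z v - ε * ∑ i, v i := by
      simp only [evalR, Pi.sub_apply, Pi.smul_apply, smul_eq_mul, mul_one, Finset.mul_sum,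
        ← Finset.sum_sub_distrib]
      refine Finset.sum_congr rfl fun i _ => by ring
    rw [e] at h3
    have : 0 < ε * ∑ i, v i := mul_pos hε0 hsp
    linarith
  · intro hz
    by_contra hni
    obtain ⟨f, hf⟩ := geometric_hahn_banach_open_point h.tits_convex.interior isOpen_interior hni
    set v : B → ℝ := fun i => - f (simpleRoot i) with hv
    have hfv : ∀ a, evalR a v = - f a := by
      intro a
      have := lin_eq_sum f.toLinearMap a
      simp only [ContinuousLinearMap.coe_coe, smul_eq_mul] at this
      rw [this]; simp [evalR, hv, mul_comm]
    have hlt : ∀ a ∈ interior (titsConeCoord ρ), evalR z v < evalR a v := by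
      intro a ha; rw [hfv, hfv]; linarith [hf a ha]
    -- test on chambers
    have key : ∀ (w : W) (y : B → ℝ), (∀ i, 0 < y i) → evalR z v < evalR y (ρ w⁻¹ v) := by
      intro w y hy
      let a : B → ℝ := fun i => evalR y (ρ w⁻¹ (simpleRoot i))
      have ha : ∀ x, evalR a x = evalR y (ρ w⁻¹ x) := by
        intro x
        have := lin_eq_sum ((evl y).comp (ρ w⁻¹).toLinearMap) x
        simp only [LinearMap.comp_apply, LinearEquiv.coe_coe, smul_eq_mul, evl_apply] at this
        rw [this]; rfl
      rw [← ha]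
      apply hlt
      apply h.chamber_int w
      intro s
      rw [ha, h.inv_apply, evalR_simple]; exact hy s
    have hvd : v ∈ dualCone ρ := by
      intro w s
      by_contra hneg
      push Not at hneg
      set c := ρ w v with hc
      set C := ∑ i, c i with hC
      -- y = 1 + T * e_s
      have h1 : ∀ T : ℝ, 0 ≤ T → evalR z v < C + T * c s := by
        intro T hT
        have := key w⁻¹ (fun i => 1 + T * simpleRoot s i)
          (fun i => by have := mul_nonneg hT (simpleRoot_nonneg s i); linarith)
        rw [inv_inv, ← hc] at this
        convert this using 1
        simp only [evalR, mul_add, Finset.sum_add_distrib, hC, mul_one]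
        congr 1
        rw [Finset.sum_eq_single s]
        · rw [simpleRoot_self]; ring
        · intro i _ hi; rw [simpleRoot_ne hi]; ring
        · intro hh; exact absurd (Finset.mem_univ s) hh
      have h2 := h1 (|C - evalR z v| / (- c s)) (by apply div_nonneg (abs_nonneg _); linarith)
      have h3 : |C - evalR z v| / (- c s) * c s = - |C - evalR z v| := by
        have : c s ≠ 0 := hneg.ne
        field_simp
      rw [h3] at h2
      linarith [le_abs_self (C - evalR z v)]
    have hv0 : v ≠ 0 := by
      intro h0
      have := hlt (fun _ => 1) (h.chamber_int 1 (fun s => by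
        rw [h.one_apply, evalR_simple]; exact one_pos))
      rw [h0] at this
      simp [evalR] at this
    have h1 := hz v hvd hv0
    have h2 := key 1 
    rw [inv_one, h.one_apply] at h2
    set C := ∑ i, v i with hC
    have hCp := sum_pos_of_nonneg (h.dualCone_nonneg hvd) hv0
    rw [← hC] at hCp
    have h3 := h2 (fun _ => evalR z v / C) (fun _ => div_pos h1 hCp)
    have : evalR (fun _ : B => evalR z v / C) v = evalR z v := by
      unfold evalR
      rw [← Finset.sum_mul, ← hC]
      field_simp
    linarith
end P4

set_option linter.unusedSectionVars false
set_option linter.unusedSimpArgs false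

section P5
variable {B : Type*} [Fintype B] [DecidableEq B] {M : CoxeterMatrix B}
    {W : Type*} [Group W] {cs : CoxeterSystem M W}
    {ρ : W →* ((B → ℝ) ≃ₗ[ℝ] (B → ℝ))}

/-- Compact base of the dual cone. -/
def dslice (ρ : W →* ((B → ℝ) ≃ₗ[ℝ] (B → ℝ))) : Set (B → ℝ) :=
  {v | v ∈ dualCone ρ ∧ ∑ i, v i = 1}

theorem IsTits.dslice_compact (h : IsTits cs ρ) : IsCompact (dslice ρ) := by
  have hsum : Continuous fun y : B → ℝ => ∑ i, y i := by fun_prop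
  refine IsCompact.of_isClosed_subset (s := Set.Icc 0 (fun _ => 1)) isCompact_Icc
    (dualCone_closed.inter (isClosed_eq hsum continuous_const)) ?_
  rintro y ⟨hy, hy2⟩
  have hy0 := h.dualCone_nonneg hy
  refine ⟨hy0, fun i => ?_⟩
  exact (Finset.single_le_sum (f := y) (fun j _ => hy0 j) (Finset.mem_univ i)).trans hy2.le

theorem dslice_convex : Convex ℝ (dslice ρ) := by
  intro x hx y hy a b ha hb hab
  refine ⟨dualCone_add (dualCone_smul hx.1 ha) (dualCone_smul hy.1 hb), ?_⟩
  simp [Finset.sum_add_distrib, ← Finset.mul_sum, hx.2, hy.2, hab]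

theorem dslice_ne_zero {v : B → ℝ} (hv : v ∈ dslice ρ) : v ≠ 0 := by
  rintro rfl
  have := hv.2
  simp at this

theorem IsTits.exists_dslice (h : IsTits cs ρ) {v : B → ℝ} (hv : v ∈ dualCone ρ) (h0 : v ≠ 0) :
    ∃ u ∈ dslice ρ, ∃ c : ℝ, 0 < c ∧ v = c • u := by
  have hs := sum_pos_of_nonneg (h.dualCone_nonneg hv) h0
  refine ⟨(∑ i, v i)⁻¹ • v, ⟨dualCone_smul hv (inv_nonneg.mpr hs.le), ?_⟩, _, hs, ?_⟩
  · simp only [Pi.smul_apply, smul_eq_mul, ← Finset.mul_sum]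
    exact inv_mul_cancel₀ hs.ne'
  · rw [smul_smul, mul_inv_cancel₀ hs.ne', one_smul]

/-- `evalC z` as a real-linear map. -/
noncomputable def evlC (z : B → ℂ) : (B → ℝ) →ₗ[ℝ] ℂ where
  toFun v := evalC z v
  map_add' x y := by simp [evalC, add_mul, Finset.sum_add_distrib]
  map_smul' c x := by simp [evalC, Finset.mul_sum, mul_assoc]

theorem evlC_apply (z : B → ℂ) (v : B → ℝ) : evlC z v = evalC z v := rfl

theorem evalC_smul (c : ℂ) (z : B → ℂ) (v : B → ℝ) : evalC (c • z) v = c * evalC z v := by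
  simp only [evalC, Pi.smul_apply, smul_eq_mul, Finset.mul_sum]
  refine Finset.sum_congr rfl fun i _ => by ring

theorem evalC_rsmul (c : ℝ) (z : B → ℂ) (v : B → ℝ) : evalC z (c • v) = c * evalC z v := by
  rw [← evlC_apply, map_smul, evlC_apply]; simp

theorem evalC_im (z : B → ℂ) (v : B → ℝ) : (evalC z v).im = evalR (fun i => (z i).im) v := by
  simp [evalC, evalR]

theorem evalC_continuous : Continuous fun p : (B → ℂ) × (B → ℝ) => evalC p.1 p.2 := by
  unfold evalC; fun_prop

theorem evalC_wact (w : W) (z : B → ℂ) (v : B → ℝ) :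
    evalC (wact ρ w z) v = evalC z (ρ w⁻¹ v) := by
  have := lin_eq_sum ((evlC z).comp (ρ w⁻¹).toLinearMap) v
  simp only [LinearMap.comp_apply, LinearEquiv.coe_coe, evlC_apply] at this
  rw [this]
  simp [evalC, wact]

theorem wact_smul (w : W) (c : ℂ) (z : B → ℂ) : wact ρ w (c • z) = c • wact ρ w z := by
  ext i; simp [wact, evalC_smul]

theorem IsTits.mem_omega (h : IsTits cs ρ) (z : B → ℂ) : z ∈ omegaReg M ρ ↔
    (∀ v ∈ dslice ρ, 0 < (evalC z v).im) ∧ ∀ α ∈ posRootSet ρ, evalC z α ≠ 0 := by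
  refine and_congr_left fun _ => ?_
  rw [h.interior_iff]
  constructor
  · intro hz v hv
    rw [evalC_im]; exact hz v hv.1 (dslice_ne_zero hv)
  · intro hz v hv h0
    obtain ⟨u, hu, c, hc, rfl⟩ := h.exists_dslice hv h0
    rw [← evalC_im, evalC_rsmul]
    simpa using mul_pos hc (hz u hu)

theorem IsTits.mem_ups (h : IsTits cs ρ) (z : B → ℂ) : z ∈ upsReg M ρ ↔
    (∀ v ∈ dslice ρ, evalC z v ≠ 0) ∧ ∀ α ∈ posRootSet ρ, evalC z α ≠ 0 := by
  refine and_congr_left fun _ => ?_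
  rw [h.imagCone_eq]
  constructor
  · intro hz v hv
    exact hz v hv.1 (dslice_ne_zero hv)
  · intro hz v hv h0
    obtain ⟨u, hu, c, hc, rfl⟩ := h.exists_dslice hv h0
    rw [evalC_rsmul]
    exact mul_ne_zero (by exact_mod_cast hc.ne') (hz u hu)

theorem IsTits.omega_sub (h : IsTits cs ρ) : omegaReg M ρ ⊆ upsReg M ρ := by
  intro z hz
  rw [h.mem_omega] at hz
  rw [h.mem_ups]
  refine ⟨fun v hv h0 => ?_, hz.2⟩
  have := hz.1 v hv
  rw [h0] at this; simp at this

theorem IsTits.dslice_empty_iff (h : IsTits cs ρ) : imagCone M ρ = {0} ↔ dslice ρ = ∅ := by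
  rw [h.imagCone_eq]
  constructor
  · intro he
    ext v
    simp only [Set.mem_empty_iff_false, iff_false]
    intro hv
    have := hv.1
    rw [he] at this
    exact dslice_ne_zero hv this
  · intro he
    ext v
    simp only [Set.mem_singleton_iff]
    constructor
    · intro hv
      by_contra h0
      obtain ⟨u, hu, -⟩ := h.exists_dslice hv h0
      rw [he] at hu; exact hu
    · rintro rfl
      intro w i; simp

theorem IsTits.finite_of_empty (h : IsTits cs ρ) (he : dslice ρ = ∅) : Finite W := by
  have hT : (fun _ => -1 : B → ℝ) ∈ titsConeCoord ρ := by
    apply interior_subset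
    rw [h.interior_iff]
    intro v hv h0
    obtain ⟨u, hu, -⟩ := h.exists_dslice hv h0
    rw [he] at hu; exact hu.elim
  rw [h.tits_iff] at hT
  have hP : (posRootSet ρ).Finite := by
    refine hT.subset fun α hα => ⟨hα, ?_⟩
    rw [evl_apply]
    have := sum_pos_of_nonneg hα.2 (h.root_ne_zero hα.1)
    simp [evalR]; exact this
  have hR : (rootSet ρ).Finite := by
    refine (hP.union (hP.image Neg.neg)).subset fun α hα => ?_
    rcases h.root_pos_or_neg hα with h1 | h1
    · exact Or.inl ⟨hα, h1⟩
    · right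
      refine ⟨-α, ⟨?_, fun i => by simpa using h1 i⟩, neg_neg α⟩
      obtain ⟨w, s, rfl⟩ := hα
      exact ⟨w * cs.simple s, s, (h.mul_simple_self w s).symm⟩
  have : Finite (rootSet ρ) := hR
  let g : W → (B → rootSet ρ) := fun w s => ⟨ρ w (simpleRoot s), w, s, rfl⟩
  refine Finite.of_injective g fun w w' hww => ?_
  have h1 : ∀ s, ρ w (simpleRoot s) = ρ w' (simpleRoot s) := fun s =>
    congrArg Subtype.val (congrFun hww s)
  have h2 : w⁻¹ * w' = 1 := by
    apply h.eq_one_of_pos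
    intro s
    rw [h.mul_apply, ← h1, h.inv_apply]
    exact simpleRoot_nonneg s
  exact (inv_mul_eq_one.mp h2)

theorem IsTits.empty_of_finite (h : IsTits cs ρ) [Finite W] : dslice ρ = ∅ := by
  have hR : (rootSet ρ).Finite := by
    have : rootSet ρ = Set.range fun p : W × B => ρ p.1 (simpleRoot p.2) := by
      ext v; simp [rootSet, eq_comm]
    rw [this]; exact Set.finite_range _
  have hT : titsConeCoord ρ = Set.univ := by
    ext z
    simp only [Set.mem_univ, iff_true]
    rw [h.tits_iff]
    exact hR.subset fun α hα => hα.1.1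
  have h0 : (0 : B → ℝ) ∈ interior (titsConeCoord ρ) := by rw [hT]; simp
  rw [h.interior_iff] at h0
  ext v
  simp only [Set.mem_empty_iff_false, iff_false]
  intro hv
  have := h0 v hv.1 (dslice_ne_zero hv)
  simp [evalR] at this

/-! ### The retraction -/

theorem IsTits.arg_image (h : IsTits cs ρ) (z : B → ℂ) :
    Complex.arg '' ((fun v => evalC z v) '' (imagCone M ρ \ {0})) =
      (fun v => Complex.arg (evalC z v)) '' dslice ρ := by
  rw [h.imagCone_eq, Set.image_image]
  apply Set.Subset.antisymm
  · rintro _ ⟨v, ⟨hv, h0⟩, rfl⟩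
    obtain ⟨u, hu, c, hc, rfl⟩ := h.exists_dslice hv h0
    refine ⟨u, hu, ?_⟩
    simp only [evalC_rsmul]
    exact (Complex.arg_real_mul _ hc).symm
  · rintro _ ⟨v, hv, rfl⟩
    exact ⟨v, ⟨hv.1, dslice_ne_zero hv⟩, rfl⟩

theorem IsTits.phiI_wact (h : IsTits cs ρ) (w : W) (z : B → ℂ) :
    phiI M ρ (wact ρ w z) = phiI M ρ z := by
  have : (fun v => evalC (wact ρ w z) v) '' (imagCone M ρ \ {0}) =
      (fun v => evalC z v) '' (imagCone M ρ \ {0}) := by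
    rw [h.imagCone_eq]
    apply Set.Subset.antisymm
    · rintro _ ⟨v, ⟨hv, h0⟩, rfl⟩
      refine ⟨ρ w⁻¹ v, ⟨h.dualCone_map hv _, ?_⟩, (evalC_wact w z v).symm⟩
      simpa using h0
    · rintro _ ⟨v, ⟨hv, h0⟩, rfl⟩
      refine ⟨ρ w v, ⟨h.dualCone_map hv _, ?_⟩, ?_⟩
      · simpa using h0
      · simp only [evalC_wact, h.inv_apply]
  unfold phiI
  rw [this]

theorem slit_of_im {x : ℂ} (hx : 0 < x.im) : x ∈ Complex.slitPlane := Or.inr hx.ne'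

theorem IsTits.phiI_continuous (h : IsTits cs ρ) :
    Continuous fun z : ↥(omegaReg M ρ) => phiI M ρ (z : B → ℂ) := by
  have : CompactSpace (dslice ρ) := isCompact_iff_compactSpace.mp h.dslice_compact
  let f : ↥(omegaReg M ρ) → ↥(dslice ρ) → ℝ := fun z v => Complex.arg (evalC (z : B → ℂ) v)
  have hf : Continuous ↿f := by
    have h1 : Continuous fun p : ↥(omegaReg M ρ) × ↥(dslice ρ) => evalC (p.1 : B → ℂ) p.2 :=
      evalC_continuous.comp (by fun_prop :
        Continuous fun p : ↥(omegaReg M ρ) × ↥(dslice ρ) => ((p.1 : B → ℂ), (p.2 : B → ℝ)))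
    rw [continuous_iff_continuousAt]
    rintro ⟨z, v⟩
    refine ContinuousAt.comp (f := fun p : ↥(omegaReg M ρ) × ↥(dslice ρ) =>
      evalC (p.1 : B → ℂ) p.2) (g := Complex.arg) ?_ h1.continuousAt
    apply Complex.continuousAt_arg
    exact slit_of_im (((h.mem_omega _).mp z.2).1 v v.2)
  have e : ∀ z : ↥(omegaReg M ρ), (fun v => Complex.arg (evalC (z : B → ℂ) v)) '' dslice ρ =
      f z '' Set.univ := by
    intro z
    ext x; simp [f]
  have h1 := (isCompact_univ (X := ↥(dslice ρ))).continuous_sSup hf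
  have h2 := (isCompact_univ (X := ↥(dslice ρ))).continuous_sInf hf
  have : (fun z : ↥(omegaReg M ρ) => phiI M ρ (z : B → ℂ)) =
      fun z => (sSup (f z '' Set.univ) + sInf (f z '' Set.univ)) / 2 := by
    funext z
    unfold phiI
    rw [h.arg_image, e]
  rw [this]
  exact (h1.add h2).div_const 2

theorem arg_rot {x : ℂ} (hx : x ≠ 0) {θ : ℝ} (h1 : 0 < x.arg + θ) (h2 : x.arg + θ < Real.pi) :
    (Complex.exp (θ * Complex.I) * x).arg = x.arg + θ := by
  have : Complex.exp (θ * Complex.I) * x = (‖x‖ : ℝ) *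
      (Complex.cos ((x.arg + θ : ℝ) : ℂ) + Complex.sin ((x.arg + θ : ℝ) : ℂ) * Complex.I) := by
    rw [← Complex.exp_mul_I]
    conv_lhs => rw [← Complex.norm_mul_exp_arg_mul_I x]
    rw [mul_left_comm, ← Complex.exp_add]
    push_cast
    ring_nf
  rw [this]
  exact Complex.arg_mul_cos_add_sin_mul_I (norm_pos_iff.mpr hx) ⟨by linarith [Real.pi_pos], h2.le⟩

theorem im_pos_of_arg {x : ℂ} (h1 : 0 < x.arg) (h2 : x.arg < Real.pi) : 0 < x.im := by
  have h3 : 0 ≤ x.im := Complex.arg_nonneg_iff.mp h1.le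
  refine lt_of_le_of_ne h3 fun h0 => ?_
  rcases le_or_gt 0 x.re with h4 | h4
  · have := Complex.arg_eq_zero_iff.mpr ⟨h4, h0.symm⟩
    linarith
  · have := Complex.arg_eq_pi_iff.mpr ⟨h4, h0.symm⟩
    linarith

theorem arg_of_im_pos {x : ℂ} (h : 0 < x.im) : 0 < x.arg ∧ x.arg < Real.pi := by
  constructor
  · refine lt_of_le_of_ne (Complex.arg_nonneg_iff.mpr h.le) fun h0 => ?_
    have := (Complex.arg_eq_zero_iff.mp h0.symm).2
    linarith
  · refine lt_of_le_of_ne (Complex.arg_le_pi x) fun h0 => ?_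
    have := (Complex.arg_eq_pi_iff.mp h0).2
    linarith

theorem IsTits.phiI_spec (h : IsTits cs ρ) (hne : (dslice ρ).Nonempty) {z : B → ℂ}
    (hz : z ∈ omegaReg M ρ) : ∃ lo hi : ℝ, 0 < lo ∧ hi < Real.pi ∧
      IsLeast ((fun v => Complex.arg (evalC z v)) '' dslice ρ) lo ∧
      IsGreatest ((fun v => Complex.arg (evalC z v)) '' dslice ρ) hi := by
  have hz' := ((h.mem_omega z).mp hz).1
  have hc : ContinuousOn (fun v => Complex.arg (evalC z v)) (dslice ρ) := by
    intro v hv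
    have h1 : Continuous fun v : B → ℝ => evalC z v :=
      evalC_continuous.comp (by fun_prop : Continuous fun v : B → ℝ => (z, v))
    refine (ContinuousAt.comp (f := fun v => evalC z v) (g := Complex.arg) ?_
      h1.continuousAt).continuousWithinAt
    exact Complex.continuousAt_arg (slit_of_im (hz' v hv))
  have hcomp := h.dslice_compact.image_of_continuousOn hc
  obtain ⟨lo, hlo⟩ := hcomp.exists_isLeast (hne.image _)
  obtain ⟨hi, hhi⟩ := hcomp.exists_isGreatest (hne.image _)
  refine ⟨lo, hi, ?_, ?_, hlo, hhi⟩
  · obtain ⟨v, hv, rfl⟩ := hlo.1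
    exact (arg_of_im_pos (hz' v hv)).1
  · obtain ⟨v, hv, rfl⟩ := hhi.1
    exact (arg_of_im_pos (hz' v hv)).2

theorem IsTits.phiI_eq (h : IsTits cs ρ) {z : B → ℂ} {lo hi : ℝ}
    (h1 : IsLeast ((fun v => Complex.arg (evalC z v)) '' dslice ρ) lo)
    (h2 : IsGreatest ((fun v => Complex.arg (evalC z v)) '' dslice ρ) hi) :
    phiI M ρ z = (hi + lo) / 2 := by
  unfold phiI
  rw [h.arg_image, h1.csInf_eq, h2.csSup_eq]

theorem IsTits.arg_rotated (h : IsTits cs ρ) (hne : (dslice ρ).Nonempty) {z : B → ℂ}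
    (hz : z ∈ omegaReg M ρ) {t : ℝ} (ht0 : 0 ≤ t) (ht1 : t ≤ 1) {v : B → ℝ} (hv : v ∈ dslice ρ) :
    0 < (evalC z v).arg + t * (Real.pi / 2 - phiI M ρ z) ∧
    (evalC z v).arg + t * (Real.pi / 2 - phiI M ρ z) < Real.pi := by
  obtain ⟨lo, hi, hlo0, hhi0, hlo, hhi⟩ := h.phiI_spec hne hz
  rw [h.phiI_eq hlo hhi]
  set a := (evalC z v).arg with ha
  have h1 : lo ≤ a := hlo.2 ⟨v, hv, rfl⟩
  have h2 : a ≤ hi := hhi.2 ⟨v, hv, rfl⟩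
  have e : a + t * (Real.pi / 2 - (hi + lo) / 2) =
    (1 - t) * a + t * (a + (Real.pi / 2 - (hi + lo) / 2)) := by ring
  rw [e]
  set b := a + (Real.pi / 2 - (hi + lo) / 2) with hb
  have b0 : 0 < b := by linarith
  have b1 : b < Real.pi := by linarith
  have a0 : 0 < a := by linarith
  have a1 : a < Real.pi := by linarith
  rcases ht1.lt_or_eq with h3 | h3
  · constructor
    · have := mul_pos (sub_pos.mpr h3) a0
      have := mul_nonneg ht0 b0.le
      linarith
    · have := mul_pos (sub_pos.mpr h3) (sub_pos.mpr a1)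
      have := mul_nonneg ht0 (sub_pos.mpr b1).le
      linarith
  · rw [h3]; constructor <;> linarith

/-- The retraction formula. -/
noncomputable def rotH (M : CoxeterMatrix B) (ρ : W →* ((B → ℝ) ≃ₗ[ℝ] (B → ℝ))) (t : ℝ)
    (z : B → ℂ) : B → ℂ :=
  Complex.exp (((t * (Real.pi / 2 - phiI M ρ z) : ℝ) : ℂ) * Complex.I) • z

theorem IsTits.rotH_mem (h : IsTits cs ρ) (hne : (dslice ρ).Nonempty) {z : B → ℂ}
    (hz : z ∈ omegaReg M ρ) {t : ℝ} (ht0 : 0 ≤ t) (ht1 : t ≤ 1) :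
    rotH M ρ t z ∈ omegaReg M ρ := by
  have hz' := (h.mem_omega z).mp hz
  rw [h.mem_omega]
  constructor
  · intro v hv
    obtain ⟨h1, h2⟩ := h.arg_rotated hne hz ht0 ht1 hv
    have h3 : evalC z v ≠ 0 := by
      intro h0; have := hz'.1 v hv; rw [h0] at this; simp at this
    unfold rotH
    rw [evalC_smul]
    apply im_pos_of_arg
    · rw [arg_rot h3 h1 h2]; exact h1
    · rw [arg_rot h3 h1 h2]; exact h2
  · intro α hα
    unfold rotH
    rw [evalC_smul]
    exact mul_ne_zero (Complex.exp_ne_zero _) (hz'.2 α hα)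

theorem IsTits.phiI_rotH (h : IsTits cs ρ) (hne : (dslice ρ).Nonempty) {z : B → ℂ}
    (hz : z ∈ omegaReg M ρ) : phiI M ρ (rotH M ρ 1 z) = Real.pi / 2 := by
  have hz' := (h.mem_omega z).mp hz
  obtain ⟨lo, hi, hlo0, hhi0, hlo, hhi⟩ := h.phiI_spec hne hz
  have hphi := h.phiI_eq hlo hhi
  have key : ∀ v ∈ dslice ρ, (evalC (rotH M ρ 1 z) v).arg =
      (evalC z v).arg + (Real.pi / 2 - phiI M ρ z) := by
    intro v hv
    obtain ⟨h1, h2⟩ := h.arg_rotated hne hz zero_le_one le_rfl hv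
    have h3 : evalC z v ≠ 0 := by
      intro h0; have := hz'.1 v hv; rw [h0] at this; simp at this
    unfold rotH
    rw [evalC_smul, arg_rot h3 h1 h2, one_mul]
  have h1 : IsLeast ((fun v => Complex.arg (evalC (rotH M ρ 1 z) v)) '' dslice ρ)
      (lo + (Real.pi / 2 - phiI M ρ z)) := by
    constructor
    · obtain ⟨v, hv, rfl⟩ := hlo.1
      exact ⟨v, hv, key v hv⟩
    · rintro _ ⟨v, hv, rfl⟩
      have : lo ≤ (evalC z v).arg := hlo.2 ⟨v, hv, rfl⟩
      simp only [key v hv]; linarith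
  have h2 : IsGreatest ((fun v => Complex.arg (evalC (rotH M ρ 1 z) v)) '' dslice ρ)
      (hi + (Real.pi / 2 - phiI M ρ z)) := by
    constructor
    · obtain ⟨v, hv, rfl⟩ := hhi.1
      exact ⟨v, hv, key v hv⟩
    · rintro _ ⟨v, hv, rfl⟩
      have : (evalC z v).arg ≤ hi := hhi.2 ⟨v, hv, rfl⟩
      simp only [key v hv]; linarith
  rw [h.phiI_eq h1 h2, hphi]; ring

theorem IsTits.part1 (h : IsTits cs ρ) :
    ∃ H : C(unitInterval × ↥(omegaReg M ρ), ↥(omegaReg M ρ)),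
      (∀ z : ↥(omegaReg M ρ), H (0, z) = z) ∧
      (∀ z : ↥(omegaReg M ρ), ((H (1, z) : ↥(omegaReg M ρ)) : B → ℂ) ∈ upsRegN M ρ) ∧
      (∀ z : ↥(omegaReg M ρ), (z : B → ℂ) ∈ upsRegN M ρ → H (1, z) = z) ∧
      (∀ (t : unitInterval) (w : W) (z z' : ↥(omegaReg M ρ)),
        (z' : B → ℂ) = wact ρ w (z : B → ℂ) →
          ((H (t, z') : ↥(omegaReg M ρ)) : B → ℂ) =
            wact ρ w ((H (t, z) : ↥(omegaReg M ρ)) : B → ℂ)) := by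
  by_cases he : imagCone M ρ = {0}
  · refine ⟨⟨Prod.snd, continuous_snd⟩, fun z => rfl, fun z => ?_, fun z _ => rfl,
      fun t w z z' hz => hz⟩
    unfold upsRegN
    rw [if_pos he]
    exact h.omega_sub z.2
  · have hne : (dslice ρ).Nonempty := by
      rw [Set.nonempty_iff_ne_empty]
      exact fun h0 => he (h.dslice_empty_iff.mpr h0)
    refine ⟨⟨fun p => ⟨rotH M ρ p.1 p.2, h.rotH_mem hne p.2.2 p.1.2.1 p.1.2.2⟩, ?_⟩, ?_, ?_, ?_, ?_⟩
    · apply Continuous.subtype_mk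
      unfold rotH
      have h1 : Continuous fun p : unitInterval × ↥(omegaReg M ρ) => phiI M ρ (p.2 : B → ℂ) :=
        h.phiI_continuous.comp continuous_snd
      fun_prop
    · intro z
      apply Subtype.ext
      simp [rotH]
    · intro z
      unfold upsRegN
      rw [if_neg he]
      exact ⟨h.omega_sub (h.rotH_mem hne z.2 zero_le_one le_rfl), h.phiI_rotH hne z.2⟩
    · intro z hz
      unfold upsRegN at hz
      rw [if_neg he] at hz
      apply Subtype.ext
      simp [rotH, hz.2]
    · intro t w z z' hz
      simp only [ContinuousMap.coe_mk, rotH]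
      rw [wact_smul, hz, h.phiI_wact]

theorem IsTits.part3 (h : IsTits cs ρ) [Finite W] : upsReg M ρ = omegaReg M ρ := by
  ext z
  rw [h.mem_ups, h.mem_omega, h.empty_of_finite]
  simp

/-! ### The homotopy equivalence -/

/-- Normalisation of a nonzero complex number. -/
noncomputable def nz (q : {q : ℂ // q ≠ 0}) : Circle :=
  ⟨(q : ℂ) / ‖(q : ℂ)‖, by
    have : ‖(q : ℂ)‖ ≠ 0 := norm_ne_zero_iff.mpr q.2
    change _ ∈ Metric.sphere (0 : ℂ) 1
    rw [mem_sphere_zero_iff_norm]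
    simp [this]⟩

theorem nz_coe (q : {q : ℂ // q ≠ 0}) : (nz q : ℂ) = (q : ℂ) / ‖(q : ℂ)‖ := rfl

theorem nz_continuous : Continuous nz := by
  apply Continuous.subtype_mk
  refine Continuous.div (by fun_prop) (by fun_prop) ?_
  intro q
  exact_mod_cast norm_ne_zero_iff.mpr q.2

/-- The imaginary unit on the circle. -/
noncomputable def cI : Circle := ⟨Complex.I, by simp [Submonoid.unitSphere]⟩

theorem cI_coe : (cI : ℂ) = Complex.I := rfl

theorem nz_re (q : {q : ℂ // q ≠ 0}) {x : ℂ} (hx : 0 < ((q : ℂ) * x).re) :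
    0 < ((cI : ℂ) * ((nz q : ℂ) * x)).im := by
  have hq : 0 < ‖(q : ℂ)‖ := norm_pos_iff.mpr q.2
  rw [cI_coe, nz_coe]
  have : (q : ℂ) / ‖(q : ℂ)‖ * x = ((‖(q : ℂ)‖⁻¹ : ℝ) : ℂ) * ((q : ℂ) * x) := by
    push_cast; ring
  rw [this, Complex.I_mul_im, Complex.re_ofReal_mul]
  exact mul_pos (inv_pos.mpr hq) hx

theorem IsTits.selection (h : IsTits cs ρ) : ∃ g : C(↥(upsReg M ρ), ℂ),
    ∀ z : ↥(upsReg M ρ), ∀ v ∈ dslice ρ, 0 < (g z * evalC (z : B → ℂ) v).re := by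
  have := exists_continuous_forall_mem_convex_of_local_const (X := ↥(upsReg M ρ)) (E := ℂ)
    (t := fun z => {q | ∀ v ∈ dslice ρ, 0 < (q * evalC (z : B → ℂ) v).re}) ?_ ?_
  · exact this
  · intro z x hx y hy a b ha hb hab v hv
    have e : ((a • x + b • y) * evalC (z : B → ℂ) v).re =
        a * (x * evalC (z : B → ℂ) v).re + b * (y * evalC (z : B → ℂ) v).re := by
      simp only [Complex.real_smul, add_mul, mul_assoc, Complex.add_re, Complex.re_ofReal_mul]
    rw [e]
    have h1 := hx v hv
    have h2 := hy v hv
    rcases ha.lt_or_eq with h3 | h3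
    · have := mul_pos h3 h1
      have := mul_nonneg hb h2.le
      linarith
    · have hb1 : b = 1 := by linarith
      rw [← h3, hb1]; linarith
  · intro z
    have hz := ((h.mem_ups z).mp z.2).1
    let L : (B → ℝ) →ₗ[ℝ] ℂ := evlC (z : B → ℂ)
    have hLc : Continuous L := L.continuous_of_finiteDimensional
    have hK : IsCompact (L '' dslice ρ) := h.dslice_compact.image hLc
    have hKc : Convex ℝ (L '' dslice ρ) := dslice_convex.linear_image L
    have h0 : (0 : ℂ) ∉ L '' dslice ρ := by
      rintro ⟨v, hv, h0⟩
      exact hz v hv h0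
    obtain ⟨f, u, hf0, hf⟩ := geometric_hahn_banach_point_closed hKc hK.isClosed h0
    rw [map_zero] at hf0
    let q : ℂ := (f 1 : ℂ) - (f Complex.I : ℂ) * Complex.I
    have hq : ∀ x : ℂ, (q * x).re = f x := by
      intro x
      have : x = x.re • (1 : ℂ) + x.im • Complex.I := by
        simp [Complex.re_add_im]
      conv_rhs => rw [this, map_add, map_smul, map_smul]
      simp [q]; ring
    refine ⟨q, ?_⟩
    refine h.dslice_compact.eventually_forall_of_forall_eventually
      (P := fun (y : ↥(upsReg M ρ)) v => 0 < (q * evalC (y : B → ℂ) v).re) ?_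
    intro v hv
    have hc : Continuous fun p : ↥(upsReg M ρ) × (B → ℝ) => (q * evalC (p.1 : B → ℂ) p.2).re := by
      have h1 : Continuous fun p : ↥(upsReg M ρ) × (B → ℝ) => evalC (p.1 : B → ℂ) p.2 :=
        evalC_continuous.comp (by fun_prop :
          Continuous fun p : ↥(upsReg M ρ) × (B → ℝ) => ((p.1 : B → ℂ), p.2))
      exact Complex.continuous_re.comp (continuous_const.mul h1)
    apply hc.continuousAt.eventually (lt_mem_nhds _)
    simp only [hq]
    exact hf0.trans (hf _ ⟨v, hv, rfl⟩)

theorem IsTits.smul_ups (h : IsTits cs ρ) (c : Circle) {z : B → ℂ} (hz : z ∈ upsReg M ρ) :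
    (c : ℂ) • z ∈ upsReg M ρ := by
  rw [h.mem_ups] at *
  refine ⟨fun v hv => ?_, fun v hv => ?_⟩
  · rw [evalC_smul]; exact mul_ne_zero (Circle.coe_ne_zero c) (hz.1 v hv)
  · rw [evalC_smul]; exact mul_ne_zero (Circle.coe_ne_zero c) (hz.2 v hv)

theorem IsTits.nz_omega (h : IsTits cs ρ) {z : B → ℂ} (hz : z ∈ upsReg M ρ)
    (q : {q : ℂ // q ≠ 0}) (hq : ∀ v ∈ dslice ρ, 0 < ((q : ℂ) * evalC z v).re) :
    ((cI * nz q : Circle) : ℂ) • z ∈ omegaReg M ρ := by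
  have hu := (h.mem_ups _).mp (h.smul_ups (cI * nz q) hz)
  rw [h.mem_omega]
  refine ⟨fun v hv => ?_, hu.2⟩
  rw [evalC_smul, Circle.coe_mul, mul_assoc]
  exact nz_re q (hq v hv)

theorem nz_mul (c : Circle) (q q' : {q : ℂ // q ≠ 0}) (hq : (q' : ℂ) = c * q) :
    nz q' = c * nz q := by
  apply Circle.ext
  rw [Circle.coe_mul, nz_coe, nz_coe, hq, norm_mul, Circle.norm_coe, one_mul, mul_div_assoc]

theorem IsTits.part2 (h : IsTits cs ρ) [Infinite W] :
    Nonempty (ContinuousMap.HomotopyEquiv ↥(upsReg M ρ) (Circle × ↥(omegaReg M ρ))) := by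
  obtain ⟨v₀, hv₀⟩ : (dslice ρ).Nonempty := by
    rw [Set.nonempty_iff_ne_empty]
    intro h0
    have := h.finite_of_empty h0
    exact not_finite W
  obtain ⟨g, hg⟩ := h.selection
  have ne_of : ∀ {q x : ℂ}, 0 < (q * x).re → q ≠ 0 := by
    rintro q x hq rfl
    simp at hq
  let q : ↥(upsReg M ρ) → {q : ℂ // q ≠ 0} := fun z => ⟨g z, ne_of (hg z v₀ hv₀)⟩
  have hqc : Continuous q := by
    apply Continuous.subtype_mk
    exact g.continuous
  let n : ↥(upsReg M ρ) → Circle := fun z => nz (q z)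
  have hnc : Continuous n := nz_continuous.comp hqc
  let F : C(↥(upsReg M ρ), Circle × ↥(omegaReg M ρ)) :=
    ⟨fun z => ((n z)⁻¹, ⟨((cI * n z : Circle) : ℂ) • (z : B → ℂ), h.nz_omega z.2 (q z) (hg z)⟩), by
      refine Continuous.prodMk (by fun_prop) ?_
      apply Continuous.subtype_mk
      fun_prop⟩
  let G : C(Circle × ↥(omegaReg M ρ), ↥(upsReg M ρ)) :=
    ⟨fun p => ⟨((cI⁻¹ * p.1 : Circle) : ℂ) • (p.2 : B → ℂ),
      h.smul_ups (cI⁻¹ * p.1) (h.omega_sub p.2.2)⟩, by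
      apply Continuous.subtype_mk
      fun_prop⟩
  -- the direction path
  let d : unitInterval × (Circle × ↥(omegaReg M ρ)) → ℂ := fun x =>
    (1 - (x.1 : ℝ) : ℝ) * (((cI⁻¹ * x.2.1 : Circle) : ℂ) * g (G x.2)) +
      ((x.1 : ℝ) : ℂ) * ((cI⁻¹ : Circle) : ℂ)
  have hd : ∀ x, ∀ v ∈ dslice ρ, 0 < (d x * evalC (x.2.2 : B → ℂ) v).re := by
    rintro ⟨t, u, z⟩ v hv
    have h1 : 0 < (((cI⁻¹ * u : Circle) : ℂ) * g (G (u, z)) * evalC (z : B → ℂ) v).re := by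
      have := hg (G (u, z)) v hv
      have e : evalC ((G (u, z) : ↥(upsReg M ρ)) : B → ℂ) v =
        ((cI⁻¹ * u : Circle) : ℂ) * evalC (z : B → ℂ) v := evalC_smul _ _ _
      rw [e] at this
      convert this using 2
      ring
    have h2 : 0 < (((cI⁻¹ : Circle) : ℂ) * evalC (z : B → ℂ) v).re := by
      have := ((h.mem_omega _).mp z.2).1 v hv
      rw [Circle.coe_inv, cI_coe, Complex.inv_I]
      simpa using this
    have e : (d (t, u, z) * evalC (z : B → ℂ) v).re =
        (1 - (t : ℝ)) * (((cI⁻¹ * u : Circle) : ℂ) * g (G (u, z)) * evalC (z : B → ℂ) v).re +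
        (t : ℝ) * (((cI⁻¹ : Circle) : ℂ) * evalC (z : B → ℂ) v).re := by
      simp only [d, add_mul, mul_assoc, Complex.add_re, Complex.re_ofReal_mul]
    rw [e]
    have ht0 : 0 ≤ (t : ℝ) := t.2.1
    have ht1 : (t : ℝ) ≤ 1 := t.2.2
    rcases ht0.lt_or_eq with h3 | h3
    · have := mul_pos h3 h2
      have := mul_nonneg (sub_nonneg.mpr ht1) h1.le
      linarith
    · rw [← h3]; linarith
  let dd : unitInterval × (Circle × ↥(omegaReg M ρ)) → {q : ℂ // q ≠ 0} :=
    fun x => ⟨d x, ne_of (hd x v₀ hv₀)⟩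
  have hddc : Continuous dd := by
    apply Continuous.subtype_mk
    fun_prop
  let D : unitInterval × (Circle × ↥(omegaReg M ρ)) → Circle := fun x => nz (dd x)
  have hDc : Continuous D := nz_continuous.comp hddc
  have hD0 : ∀ p, D (0, p) = cI⁻¹ * p.1 * n (G p) := by
    intro p
    apply nz_mul
    simp [dd, d, q]
  have hD1 : ∀ p, D (1, p) = cI⁻¹ := by
    intro p
    have := nz_mul cI⁻¹ ⟨1, one_ne_zero⟩ (dd (1, p)) (by simp [dd, d])
    have h1 : nz ⟨1, one_ne_zero⟩ = 1 := by
      apply Circle.ext; rw [nz_coe]; simp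
    rw [h1, mul_one] at this
    exact this
  refine ⟨⟨F, G, ?_, ?_⟩⟩
  · have : G.comp F = ContinuousMap.id _ := by
      ext1 z
      apply Subtype.ext
      change ((cI⁻¹ * (n z)⁻¹ : Circle) : ℂ) • (((cI * n z : Circle) : ℂ) • (z : B → ℂ)) = z
      rw [smul_smul, ← Circle.coe_mul]
      have : cI⁻¹ * (n z)⁻¹ * (cI * n z) = 1 := by
        rw [mul_comm cI (n z)]; group
      rw [this]; simp
    rw [this]
  · refine ⟨⟨⟨fun x => (cI⁻¹ * x.2.1 * (D x)⁻¹, ⟨((cI * D x : Circle) : ℂ) • (x.2.2 : B → ℂ),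
      h.nz_omega (h.omega_sub x.2.2.2) (dd x) (hd x)⟩), ?_⟩, ?_, ?_⟩⟩
    · refine Continuous.prodMk (by fun_prop) ?_
      apply Continuous.subtype_mk
      fun_prop
    · intro p
      refine Prod.ext ?_ (Subtype.ext ?_)
      · change cI⁻¹ * p.1 * (D (0, p))⁻¹ = (n (G p))⁻¹
        rw [hD0, mul_inv, mul_inv_cancel_left]
      · change ((cI * D (0, p) : Circle) : ℂ) • (p.2 : B → ℂ) =
          ((cI * n (G p) : Circle) : ℂ) • (((cI⁻¹ * p.1 : Circle) : ℂ) • (p.2 : B → ℂ))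
        rw [smul_smul, ← Circle.coe_mul, hD0]
        congr 2
        rw [mul_assoc cI (n (G p)), mul_comm (n (G p))]
    · intro p
      refine Prod.ext ?_ (Subtype.ext ?_)
      · change cI⁻¹ * p.1 * (D (1, p))⁻¹ = p.1
        rw [hD1, mul_comm cI⁻¹]; group
      · change ((cI * D (1, p) : Circle) : ℂ) • (p.2 : B → ℂ) = p.2
        rw [hD1]; simp
end P5

/-!
STATEMENT 14: There is a W-equivariant deformation retraction from Ω_reg onto Υ_reg^N; in
particular, when W is infinite, Υ_reg is homotopy equivalent to S¹ × Ω_reg, and when W is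
finite, Υ_reg = Ω_reg.
-/
theorem equivariant_deformation_retraction_omegaReg
    {B : Type*} [Fintype B] [DecidableEq B] (M : CoxeterMatrix B)
    {W : Type*} [Group W] (cs : CoxeterSystem M W)
    (ρ : W →* ((B → ℝ) ≃ₗ[ℝ] (B → ℝ)))
    (hρ : ∀ (s : B) (v : B → ℝ),
      ρ (cs.simple s) v = v - coxForm M (simpleRoot s) v • simpleRoot s) :
    (∃ H : C(unitInterval × ↥(omegaReg M ρ), ↥(omegaReg M ρ)),
      (∀ z : ↥(omegaReg M ρ), H (0, z) = z) ∧
      (∀ z : ↥(omegaReg M ρ), ((H (1, z) : ↥(omegaReg M ρ)) : B → ℂ) ∈ upsRegN M ρ) ∧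
      (∀ z : ↥(omegaReg M ρ), (z : B → ℂ) ∈ upsRegN M ρ → H (1, z) = z) ∧
      (∀ (t : unitInterval) (w : W) (z z' : ↥(omegaReg M ρ)),
        (z' : B → ℂ) = wact ρ w (z : B → ℂ) →
          ((H (t, z') : ↥(omegaReg M ρ)) : B → ℂ) =
            wact ρ w ((H (t, z) : ↥(omegaReg M ρ)) : B → ℂ))) ∧
    (Infinite W →
      Nonempty (ContinuousMap.HomotopyEquiv ↥(upsReg M ρ) (Circle × ↥(omegaReg M ρ)))) ∧
    (Finite W → upsReg M ρ = omegaReg M ρ) := by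
  have h : IsTits cs ρ := hρ
  exact ⟨h.part1, fun _ => h.part2, fun _ => h.part3⟩
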